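/- arXiv:1809.01443 — 4 statements merged into one kernel-verified Lean document; each statement's English description precedes it below -/
import Mathlib

section
/- For every integer $d \ge 2$ and every real $\epsilon > 0$ there exists $t_0$ such that for every integer $t \ge t_0$ there is a family $\{(A_i^1, A_i^2, \ldots, A_i^d) : 1 \le i \le t\}$ of finite sets with the property that $A_i^j \cap A_{i'}^{j'} = \emptyset$ if and only if $i = i'$ and $j \ne j'$, and whose total size satisfies $\sum_{i=1}^{t} \sum_{j=1}^{d} |A_i^j| \le \left(\tfrac{1}{2} + \epsilon\right) d\, t \log_2 t$. -/
lemma syndrome {T E : Type} [Fintype T] [DecidableEq T] [Fintype E] [DecidableEq E]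
    (L N : ℕ) [NeZero N] (c : E → T → ZMod N) :
    ∃ C : Finset ((E → Fin L) → T),
      Fintype.card T ^ (L ^ Fintype.card E) ≤ C.card * N ^ ((L + 1) ^ Fintype.card E) ∧
      ∀ X ∈ C, ∀ Y ∈ C, X ≠ Y → ∀ e, ∃ q, X q ≠ Y q ∧ c e (X q) = c e (Y q) := by
  classical
  let sh : (E → Fin L) → E → (E → Fin (L + 1)) :=
    fun q e i => if i = e then (q i).succ else (q i).castSucc
  let Φ : ((E → Fin L) → T) → ((E → Fin (L + 1)) → ZMod N) :=
    fun X p => ∑ q, ∑ e, if sh q e = p then c e (X q) else 0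
  obtain ⟨y, -, hy⟩ := Finset.exists_max_image (Finset.univ : Finset ((E → Fin (L + 1)) → ZMod N))
    (fun y => (Finset.univ.filter (fun X => Φ X = y)).card) Finset.univ_nonempty
  refine ⟨Finset.univ.filter (fun X => Φ X = y), ?_, ?_⟩
  · have h1 := Finset.card_eq_sum_card_fiberwise (f := Φ)
      (s := Finset.univ) (t := Finset.univ) (fun _ _ => by simp)
    have h2 := Finset.sum_le_card_nsmul Finset.univ _ _ hy
    rw [← h1] at h2
    simpa [Fintype.card_fun, ZMod.card, mul_comm] using h2
  · intro X hX Y hY hne e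
    simp only [Finset.mem_filter, Finset.mem_univ, true_and] at hX hY
    obtain ⟨q0, hq0⟩ := Function.ne_iff.1 hne
    obtain ⟨q, hq, hmax⟩ := Finset.exists_max_image
      (Finset.univ.filter (fun q => X q ≠ Y q)) (fun q => q e) ⟨q0, by simpa using hq0⟩
    simp only [Finset.mem_filter, Finset.mem_univ, true_and] at hq hmax
    refine ⟨q, hq, ?_⟩
    have hΦ : Φ X (sh q e) - Φ Y (sh q e) = 0 := by rw [hX, hY, sub_self]
    simp only [Φ, ← Finset.sum_sub_distrib] at hΦ
    rw [Finset.sum_eq_single q, Finset.sum_eq_single e] at hΦ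
    · simpa [sub_eq_zero] using hΦ
    · intro e' _ he'
      have : sh q e' ≠ sh q e := by
        intro h
        have := congrFun h e
        simp only [sh, if_true, if_neg he'.symm] at this
        have := congrArg Fin.val this
        simp at this
      simp [this]
    · simp
    · intro q' _ hq'
      apply Finset.sum_eq_zero
      intro e' _
      by_cases hXY : X q' = Y q'
      · simp [hXY]
      have : sh q' e' ≠ sh q e := by
        intro h
        by_cases he : e' = e
        · subst he
          apply hq'
          funext i
          have := congrArg Fin.val (congrFun h i)
          simp only [sh] at this
          split_ifs at this <;> (ext; simpa using this)
        · have := congrArg Fin.val (congrFun h e)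
          simp only [sh, if_true, if_neg (Ne.symm he)] at this
          have h3 := hmax q' hXY
          rw [Fin.le_def] at h3
          simp at this
          omega
      simp [this]
    · simp

abbrev BW (d s : ℕ) : Type :=
  {x : Fin d × Fin s → Fin d // ∀ a, (Finset.univ.filter (fun p => x p = a)).card = s}

def coll {d s : ℕ} (e : Fin d × Fin d) (x : BW d s) : Fin d × Fin s → Fin d :=
  fun p => if x.1 p = e.2 then e.1 else x.1 p

lemma cell_good {d s : ℕ} (a b : Fin d) (x y : BW d s) (hxy : x ≠ y)
    (h : coll (a, b) x = coll (a, b) y) : ∃ p, x.1 p = a ∧ y.1 p = b := by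
  classical
  by_contra hcon
  push Not at hcon
  have key : ∀ p, x.1 p = y.1 p ∨ (x.1 p = b ∧ y.1 p = a) := by
    intro p
    have h1 := congrFun h p
    have h2 := hcon p
    simp only [coll] at h1
    by_cases hx : x.1 p = b <;> by_cases hy : y.1 p = b <;> simp_all
  apply hxy
  have hsub : Finset.univ.filter (fun p => x.1 p = a) ⊆ Finset.univ.filter (fun p => y.1 p = a) := by
    intro p hp
    simp only [Finset.mem_filter, Finset.mem_univ, true_and] at hp ⊢
    rcases key p with h' | h'
    · rw [← h', hp]
    · exact h'.2
  have heq := Finset.eq_of_subset_of_card_le hsub (by rw [x.2 a, y.2 a])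
  apply Subtype.ext
  funext p
  rcases key p with h' | h'
  · exact h'
  · have : p ∈ Finset.univ.filter (fun p => y.1 p = a) := by simp [h'.2]
    rw [← heq] at this
    simp only [Finset.mem_filter, Finset.mem_univ, true_and] at this
    rw [this, h'.2]

lemma cell_card {d s : ℕ} (a b : Fin d) (hab : a ≠ b) (x : BW d s) :
    Nat.centralBinom s ≤ (Finset.univ.filter (fun y : BW d s => coll (a, b) y = coll (a, b) x)).card := by
  classical
  let P : Fin d → Finset (Fin d × Fin s) := fun c => Finset.univ.filter (fun p => x.1 p = c)
  let U := P a ∪ P b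
  have hdis : Disjoint (P a) (P b) := by
    rw [Finset.disjoint_left]
    intro p hp hp'
    simp only [P, Finset.mem_filter, Finset.mem_univ, true_and] at hp hp'
    exact hab (hp.symm.trans hp')
  have hU : U.card = 2 * s := by
    rw [Finset.card_union_of_disjoint hdis, x.2 a, x.2 b]; ring
  have memU : ∀ p, p ∈ U ↔ x.1 p = a ∨ x.1 p = b := by intro p; simp [U, P]
  have hc : Nat.centralBinom s = (Finset.powersetCard s U).card := by
    rw [Finset.card_powersetCard, hU, Nat.centralBinom]
  let w : Finset (Fin d × Fin s) → Fin d × Fin s → Fin d :=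
    fun S p => if p ∈ S then a else if p ∈ U then b else x.1 p
  have hw : ∀ S ∈ Finset.powersetCard s U, ∀ c, (Finset.univ.filter (fun p => w S p = c)).card = s := by
    intro S hS c
    rw [Finset.mem_powersetCard] at hS
    by_cases hca : c = a
    · subst hca
      convert hS.2 using 2
      ext p
      simp only [Finset.mem_filter, Finset.mem_univ, true_and, w]
      have := memU p
      by_cases h1 : p ∈ S <;> by_cases h2 : p ∈ U <;> simp_all [eq_comm]
    · by_cases hcb : c = b
      · subst hcb
        have : (Finset.univ.filter (fun p => w S p = c)) = U \ S := by
          ext p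
          simp only [Finset.mem_filter, Finset.mem_univ, true_and, w, Finset.mem_sdiff]
          have := memU p
          by_cases h1 : p ∈ S <;> by_cases h2 : p ∈ U <;> simp_all [eq_comm]
        rw [this, Finset.card_sdiff_of_subset hS.1, hU, hS.2]; omega
      · refine Eq.trans ?_ (x.2 c)
        congr 1
        ext p
        simp only [Finset.mem_filter, Finset.mem_univ, true_and, w]
        have := memU p
        have h3 : p ∈ S → p ∈ U := fun h => hS.1 h
        by_cases h1 : p ∈ S
        · have h2 := (memU p).1 (h3 h1)
          rcases h2 with h2 | h2 <;> simp [h1, h2, Ne.symm hca, Ne.symm hcb]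
        · by_cases h2 : p ∈ U
          · have h4 := (memU p).1 h2
            rcases h4 with h4 | h4 <;> simp [h1, h2, h4, Ne.symm hca, Ne.symm hcb]
          · simp [h1, h2]
  rw [hc]
  refine Finset.card_le_card_of_injOn
    (fun S => if h : S ∈ Finset.powersetCard s U then ⟨w S, hw S h⟩ else x) ?_ ?_
  · intro S hS
    have hS' : S ∈ Finset.powersetCard s U := hS
    simp only [hS', dif_pos, Finset.coe_filter, Finset.mem_univ, true_and, Set.mem_ofPred_eq]
    funext p
    have h3 : p ∈ S → p ∈ U := fun h => (Finset.mem_powersetCard.1 hS').1 h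
    have h4 := memU p
    simp only [coll, w]
    by_cases h1 : p ∈ S
    · rcases h4.1 (h3 h1) with h2 | h2 <;> simp [h1, h2, hab]
    · by_cases h2 : p ∈ U
      · rcases h4.1 h2 with h5 | h5 <;> simp [h1, h2, h5]
      · simp [h1, h2]
  · intro S hS S' hS' h
    have hS1 : S ∈ Finset.powersetCard s U := hS
    have hS1' : S' ∈ Finset.powersetCard s U := hS'
    simp only [hS1, hS1', dif_pos, Subtype.mk.injEq] at h
    have gen : ∀ R ∈ Finset.powersetCard s U, ∀ p, p ∈ R ↔ w R p = a := by
      intro R hR p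
      have h4 := memU p
      by_cases h1 : p ∈ R
      · simp [w, h1]
      · by_cases h2 : p ∈ U
        · simp [w, h1, h2, hab.symm]
        · have : x.1 p ≠ a := fun h => h2 (h4.2 (Or.inl h))
          simp [w, h1, h2, this]
    ext p
    rw [gen S hS1, gen S' hS1', h]

abbrev PE (d : ℕ) : Type := {e : Fin d × Fin d // e.1 ≠ e.2}

lemma words (d s L : ℕ) (hd : 2 ≤ d) :
    ∃ C : Finset ((PE d → Fin L) → BW d s),
      Nat.centralBinom s ^ (L ^ Fintype.card (PE d)) ≤
        C.card * (d ^ (d * s)) ^ ((L + 1) ^ Fintype.card (PE d) - L ^ Fintype.card (PE d)) ∧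
      ∀ X ∈ C, ∀ Y ∈ C, X ≠ Y → ∀ a b, a ≠ b → ∃ q p, (X q).1 p = a ∧ (Y q).1 p = b := by
  classical
  set M := Nat.centralBinom s with hM
  have hMpos : 0 < M := Nat.centralBinom_pos s
  set τ := Fintype.card (BW d s) with hτ
  set N := τ / M with hN
  have himg : ∀ e : PE d, (Finset.univ.image (coll (s := s) e.1)).card ≤ N := by
    intro e
    rw [hN, Nat.le_div_iff_mul_le hMpos, mul_comm]
    refine Finset.mul_card_image_le_card _ _ ?_
    intro y hy
    obtain ⟨x, -, rfl⟩ := Finset.mem_image.1 hy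
    exact cell_card e.1.1 e.1.2 e.2 x
  have hE : Nonempty (PE d) := ⟨⟨(⟨0, by omega⟩, ⟨1, by omega⟩), by simp⟩⟩
  obtain ⟨e0⟩ := hE
  have hx : ∀ a, (Finset.univ.filter (fun p : Fin d × Fin s => p.1 = a)).card = s := by
    intro a
    have : (Finset.univ.filter (fun p : Fin d × Fin s => p.1 = a)) = {a} ×ˢ Finset.univ := by
      ext ⟨p1, p2⟩; simp [eq_comm]
    rw [this]; simp
  have hNpos : 0 < N := lt_of_lt_of_le (Finset.card_pos.2 ⟨_, Finset.mem_image_of_mem _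
    (Finset.mem_univ (⟨fun p => p.1, hx⟩ : BW d s))⟩) (himg e0)
  have : NeZero N := ⟨hNpos.ne'⟩
  have hlab : ∀ e : PE d, ∃ f : BW d s → ZMod N, ∀ x y, f x = f y → coll e.1 x = coll e.1 y := by
    intro e
    have hcard : Fintype.card (Finset.univ.image (coll (s := s) e.1)) ≤ Fintype.card (ZMod N) := by
      rw [ZMod.card, Fintype.card_coe]; exact himg e
    obtain ⟨g⟩ := Function.Embedding.nonempty_of_card_le hcard
    refine ⟨fun x => g ⟨coll e.1 x, Finset.mem_image_of_mem _ (Finset.mem_univ x)⟩, ?_⟩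
    intro x y h
    simpa using g.injective h
  choose c hc using hlab
  obtain ⟨C, hC1, hC2⟩ := syndrome L N c
  refine ⟨C, ?_, ?_⟩
  · set B := L ^ Fintype.card (PE d)
    set P := (L + 1) ^ Fintype.card (PE d)
    have hBP : B ≤ P := Nat.pow_le_pow_left (Nat.le_succ L) _
    have h1 : M * N ≤ τ := Nat.mul_div_le τ M
    have hτle : τ ≤ d ^ (d * s) := by
      calc τ ≤ Fintype.card (Fin d × Fin s → Fin d) := Fintype.card_subtype_le _
        _ = _ := by simp
    have h2 : N ≤ d ^ (d * s) := (Nat.div_le_self _ _).trans hτle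
    have h3 : M ^ B * N ^ B ≤ (C.card * N ^ (P - B)) * N ^ B := by
      calc M ^ B * N ^ B = (M * N) ^ B := (mul_pow _ _ _).symm
        _ ≤ τ ^ B := Nat.pow_le_pow_left h1 _
        _ ≤ C.card * N ^ P := hC1
        _ = _ := by rw [mul_assoc, ← pow_add, Nat.sub_add_cancel hBP]
    have h4 := Nat.le_of_mul_le_mul_right h3 (pow_pos hNpos _)
    exact h4.trans (Nat.mul_le_mul_left _ (Nat.pow_le_pow_left h2 _))
  · intro X hX Y hY hne a b hab
    obtain ⟨q, hq, hq'⟩ := hC2 X hX Y hY hne ⟨(a, b), hab⟩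
    obtain ⟨p, hp⟩ := cell_good a b _ _ hq (hc _ _ _ hq')
    exact ⟨q, p, hp⟩


lemma family (d s L t : ℕ) (C : Finset ((PE d → Fin L) → BW d s))
    (hC : ∀ X ∈ C, ∀ Y ∈ C, X ≠ Y → ∀ a b, a ≠ b → ∃ q p, (X q).1 p = a ∧ (Y q).1 p = b)
    (ht : t ≤ C.card) :
    ∃ A : Fin t → Fin d → Finset ℕ,
      (∀ (i i' : Fin t) (j j' : Fin d), A i j ∩ A i' j' = ∅ ↔ (i = i' ∧ j ≠ j')) ∧
      ∀ i j, (A i j).card = L ^ Fintype.card (PE d) * s + 1 := by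
  classical
  let Pos : Type := ((PE d → Fin L) × (Fin d × Fin s)) ⊕ Fin d
  let g : Pos ↪ ℕ := (Fintype.equivFin Pos).toEmbedding.trans Fin.valEmbedding
  have hcard : Fintype.card (Fin t) ≤ Fintype.card C := by simpa using ht
  obtain ⟨f⟩ := Function.Embedding.nonempty_of_card_le hcard
  let X : Fin t → (PE d → Fin L) → BW d s := fun i => (f i).1
  let col : Fin t → Pos → Fin d := fun i => Sum.elim (fun z => (X i z.1).1 z.2) id
  let A0 : Fin t → Fin d → Finset Pos := fun i j => Finset.univ.filter (fun z => col i z = j)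
  refine ⟨fun i j => (A0 i j).map g, ?_, ?_⟩
  · intro i i' j j'
    rw [← Finset.map_inter, Finset.map_eq_empty]
    constructor
    · intro h
      have hnot : ∀ z, ¬ (col i z = j ∧ col i' z = j') := by
        intro z hz
        have : z ∈ A0 i j ∩ A0 i' j' := by simp [A0, hz.1, hz.2]
        rw [h] at this
        simp at this
      have hj : j ≠ j' := by
        rintro rfl
        exact hnot (Sum.inr j) ⟨rfl, rfl⟩
      refine ⟨?_, hj⟩
      by_contra hi
      have hX : X i ≠ X i' := fun h => hi (f.injective (Subtype.ext h))
      obtain ⟨q, p, h1, h2⟩ := hC _ (f i).2 _ (f i').2 hX j j' hj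
      exact hnot (Sum.inl (q, p)) ⟨h1, h2⟩
    · rintro ⟨rfl, hj⟩
      ext z
      simp only [A0, Finset.mem_inter, Finset.mem_filter, Finset.mem_univ, true_and]
      constructor
      · rintro ⟨h1, h2⟩
        exact absurd (h1.symm.trans h2) hj
      · simp
  · intro i j
    rw [Finset.card_map]
    have h1 : (A0 i j) = (Finset.univ.filter
        (fun z : (PE d → Fin L) × (Fin d × Fin s) => (X i z.1).1 z.2 = j)).disjSum {j} := by
      ext z
      rcases z with z | z
      · refine Iff.trans ?_ Finset.inl_mem_disjSum.symm
        simp [A0, col]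
      · refine Iff.trans ?_ Finset.inr_mem_disjSum.symm
        simp [A0, col]
    have h2 : (Finset.univ.filter
        (fun z : (PE d → Fin L) × (Fin d × Fin s) => (X i z.1).1 z.2 = j)).card
        = L ^ Fintype.card (PE d) * s := by
      rw [Finset.card_filter, Fintype.sum_prod_type]
      have : ∀ q : PE d → Fin L, (∑ p, if (X i q).1 p = j then 1 else 0) = s := by
        intro q
        rw [← Finset.card_filter]
        exact (X i q).2 j
      simp only [this]
      simp
    rw [h1, Finset.card_disjSum, h2]
    simp

lemma exists_L (m : ℕ) (δ : ℝ) (hδ : 0 < δ) :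
    ∃ L : ℕ, 0 < L ∧ ((L + 1 : ℝ) ^ m - (L : ℝ) ^ m) ≤ δ * (L : ℝ) ^ m := by
  have h1 : Filter.Tendsto (fun L : ℕ => (1 + 1 / (L : ℝ)) ^ m) Filter.atTop (nhds ((1 + 0) ^ m)) :=
    (tendsto_const_nhds.add tendsto_one_div_atTop_nhds_zero_nat).pow m
  have h2 : ∀ᶠ L : ℕ in Filter.atTop, (1 + 1 / (L : ℝ)) ^ m < 1 + δ :=
    h1.eventually_lt_const (by simpa using hδ)
  obtain ⟨L, hL, hL0⟩ := (h2.and (Filter.eventually_gt_atTop 0)).exists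
  refine ⟨L, hL0, ?_⟩
  have hLr : (0 : ℝ) < L := by exact_mod_cast hL0
  have h3 : (L + 1 : ℝ) ^ m = (1 + 1 / (L : ℝ)) ^ m * (L : ℝ) ^ m := by
    rw [← mul_pow]; congr 1; field_simp
  have h4 : (0 : ℝ) < (L : ℝ) ^ m := by positivity
  rw [h3]
  nlinarith

lemma exists_s (η : ℝ) (hη : 0 < η) :
    ∃ s0 : ℕ, ∀ s : ℕ, s0 ≤ s → Real.logb 2 (2 * s) ≤ η * s := by
  have h1 : Filter.Tendsto (fun s : ℕ => 2 * (s : ℝ)) Filter.atTop Filter.atTop :=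
    tendsto_natCast_atTop_atTop.const_mul_atTop two_pos
  have hl2 : 0 < Real.log 2 := Real.log_pos one_lt_two
  have h2 := h1.eventually ((Real.isLittleO_log_id_atTop).bound
    (show 0 < η * Real.log 2 / 2 by positivity))
  obtain ⟨s0, hs0⟩ := Filter.eventually_atTop.1 h2
  refine ⟨s0, fun s hs => ?_⟩
  have := hs0 s hs
  have h3 := (Real.le_norm_self _).trans this
  rw [Real.logb, div_le_iff₀ hl2]
  simp only [id, Real.norm_eq_abs, abs_of_nonneg (show (0 : ℝ) ≤ 2 * s by positivity)] at h3
  nlinarith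

theorem stmt1 (d : ℕ) (hd : 2 ≤ d) (ε : ℝ) (hε : 0 < ε) :
    ∃ t0 : ℕ, ∀ t : ℕ, t0 ≤ t →
      ∃ A : Fin t → Fin d → Finset ℕ,
        (∀ (i i' : Fin t) (j j' : Fin d),
          A i j ∩ A i' j' = ∅ ↔ (i = i' ∧ j ≠ j')) ∧
        (∑ i : Fin t, ∑ j : Fin d, ((A i j).card : ℝ)) ≤
          (1 / 2 + ε) * d * t * Real.logb 2 t := by
  set m := Fintype.card (PE d) with hm
  set η : ℝ := ε / (1 + ε) with hη
  have hηpos : 0 < η := by positivity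
  set K : ℝ := d * Real.logb 2 d with hK
  have hd1 : (1 : ℝ) < d := by exact_mod_cast hd
  have hlogd : 0 < Real.logb 2 d := Real.logb_pos one_lt_two hd1
  have hKpos : 0 < K := by positivity
  obtain ⟨L, hL0, hL⟩ := exists_L m (η / K) (by positivity)
  obtain ⟨s0, hs0⟩ := exists_s η hηpos
  set B : ℕ := L ^ m with hB
  have hBpos : 0 < B := by positivity
  have hBr : (0 : ℝ) < B := by exact_mod_cast hBpos
  have hlog : Filter.Tendsto (fun t : ℕ => Real.logb 2 t) Filter.atTop Filter.atTop :=
    (Real.tendsto_logb_atTop one_lt_two).comp tendsto_natCast_atTop_atTop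
  have hev := (hlog.eventually_ge_atTop ((B + 1) * 2 / ε)).and
    ((hlog.eventually_ge_atTop ((s0 + 1) * (2 * B))).and (Filter.eventually_gt_atTop 0))
  obtain ⟨t0, ht0⟩ := Filter.eventually_atTop.1 hev
  refine ⟨t0, fun t ht => ?_⟩
  obtain ⟨hl1, hl2, htpos⟩ := ht0 t ht
  set ℓ := Real.logb 2 t with hℓ
  have hℓpos : 0 < ℓ := lt_of_lt_of_le (by positivity) hl2
  set s := ⌈ℓ * (1 + ε) / (2 * B)⌉₊ with hs
  have hsge : ℓ * (1 + ε) / (2 * B) ≤ s := Nat.le_ceil _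
  have hslt : (s : ℝ) < ℓ * (1 + ε) / (2 * B) + 1 := Nat.ceil_lt_add_one (by positivity)
  have hss : (s0 + 1 : ℝ) ≤ s := by
    refine le_trans ?_ hsge
    rw [le_div_iff₀ (by positivity)]
    nlinarith
  have hss0 : s0 ≤ s := by
    have : (s0 : ℝ) ≤ s := by linarith
    exact_mod_cast this
  have hspos : 0 < s := by
    have : (0 : ℝ) < s := lt_of_lt_of_le (by positivity) hss
    exact_mod_cast this
  have hsr : (0 : ℝ) < s := by exact_mod_cast hspos
  obtain ⟨C, hC1, hC2⟩ := words d s L hd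
  have htC : t ≤ C.card := by
    rw [← hm, ← hB] at hC1
    set D := (L + 1) ^ m - B with hD
    have hDr : (D : ℝ) * K ≤ η * B := by
      have h1 : B ≤ (L + 1) ^ m := Nat.pow_le_pow_left (Nat.le_succ L) _
      rw [hD, Nat.cast_sub h1, hB]
      push_cast
      calc _ ≤ (η / K * (L : ℝ) ^ m) * K := mul_le_mul_of_nonneg_right hL hKpos.le
        _ = _ := by field_simp
    have hcb : (0 : ℝ) < Nat.centralBinom s := by exact_mod_cast Nat.centralBinom_pos s
    have hCpos : 0 < C.card := by
      rcases Nat.eq_zero_or_pos C.card with h | h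
      · rw [h, zero_mul] at hC1
        exact absurd hC1 (not_le.2 (pow_pos (Nat.centralBinom_pos s) _))
      · exact h
    have hCr : (0 : ℝ) < C.card := by exact_mod_cast hCpos
    have h2 : (Nat.centralBinom s : ℝ) ^ B ≤ C.card * ((d : ℝ) ^ (d * s)) ^ D := by
      exact_mod_cast hC1
    have h3 := Real.logb_le_logb_of_le one_lt_two (by positivity) h2
    rw [Real.logb_mul hCr.ne' (by positivity), Real.logb_pow, Real.logb_pow, Real.logb_pow] at h3
    have h4 : (4 : ℝ) ^ s ≤ (2 * s) * Nat.centralBinom s := by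
      exact_mod_cast Nat.four_pow_le_two_mul_self_mul_centralBinom s hspos
    have h5 := Real.logb_le_logb_of_le one_lt_two (by positivity) h4
    rw [Real.logb_mul (by positivity) hcb.ne', Real.logb_pow] at h5
    have h6 : Real.logb 2 4 = 2 := by
      rw [show (4 : ℝ) = 2 ^ (2 : ℕ) by norm_num, Real.logb_pow, Real.logb_self_eq_one one_lt_two]
      norm_num
    rw [h6] at h5
    have h7 := hs0 s hss0
    have h8 : (D : ℝ) * ((d * s : ℕ) * Real.logb 2 d) ≤ η * B * s := by
      have : (D : ℝ) * ((d * s : ℕ) * Real.logb 2 d) = (D * K) * s := by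
        rw [hK]; push_cast; ring
      rw [this]
      exact mul_le_mul_of_nonneg_right hDr hsr.le
    have h9 : (B : ℝ) * (s * 2 - η * s) ≤ B * Real.logb 2 (Nat.centralBinom s) :=
      mul_le_mul_of_nonneg_left (by linarith) hBr.le
    have h10 : ℓ ≤ (B : ℝ) * s * (2 - 2 * η) := by
      have : (2 - 2 * η) = 2 / (1 + ε) := by rw [hη]; field_simp; ring
      rw [this]
      rw [div_le_iff₀ (by positivity)] at hsge
      rw [mul_div_assoc', le_div_iff₀ (by positivity)]
      linarith
    have h11 : ℓ ≤ Real.logb 2 C.card := by nlinarith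
    have h12 := (Real.logb_le_logb one_lt_two (by exact_mod_cast htpos) hCr).1 h11
    exact_mod_cast h12
  obtain ⟨A, hA1, hA2⟩ := family d s L t C hC2 htC
  refine ⟨A, hA1, ?_⟩
  simp only [hA2, ← hm, ← hB, Finset.sum_const, Finset.card_univ, Fintype.card_fin, nsmul_eq_mul]
  push_cast
  have h1 : (B : ℝ) * s + 1 ≤ (1 / 2 + ε) * ℓ := by
    have h2 : (B : ℝ) * s ≤ ℓ * (1 + ε) / 2 + B := by
      calc (B : ℝ) * s ≤ B * (ℓ * (1 + ε) / (2 * B) + 1) := mul_le_mul_of_nonneg_left hslt.le hBr.le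
        _ = _ := by field_simp
    rw [div_le_iff₀ hε] at hl1
    linarith
  calc (t : ℝ) * (d * (B * s + 1)) ≤ t * (d * ((1 / 2 + ε) * ℓ)) := by gcongr
    _ = _ := by ring
end

section
/- For every fixed integer $d \ge 2$, the sigma clique cover number of the complete $t$-partite graph $K_t(d)$ with all parts of size $d$ satisfies $\lim_{t \to \infty} \frac{scc(K_t(d))}{t \log_2 t} = \frac{d}{2}$. -/
open Finset

/-- The sigma clique cover number of a graph `G`: the least possible total weight
(sum of sizes, with multiplicity) of a family of cliques of `G` covering all
edges of `G`. -/
noncomputable def sigmaCliqueCover {V : Type*} (G : SimpleGraph V) : ℕ :=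
  sInf {w : ℕ | ∃ C : Multiset (Finset V),
    (∀ c ∈ C, G.IsClique (c : Set V)) ∧
    (∀ u v : V, G.Adj u v → ∃ c ∈ C, u ∈ c ∧ v ∈ c) ∧
    (C.map Finset.card).sum = w}

/-- `Ktd t d` is the complete `t`-partite graph with every part of size `d`. -/
def Ktd (t d : ℕ) : SimpleGraph (Σ _ : Fin t, Fin d) :=
  SimpleGraph.completeMultipartiteGraph (fun _ : Fin t => Fin d)

/-! ### Upper bound: from a code to a clique cover -/

/-- A code: words such that any two distinct ones (in either order) show every pair of distinct
letters in some position. -/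
def IsGoodCode {d : ℕ} {P W : Type*} (f : W → P → Fin d) : Prop :=
  ∀ i j : W, i ≠ j → ∀ a b : Fin d, a ≠ b → ∃ p, f i p = a ∧ f j p = b

theorem scc_le_of_code {t d : ℕ} {P : Type*} [Fintype P] (f : Fin t → P → Fin d)
    (hf : IsGoodCode f) :
    sigmaCliqueCover (Ktd t d) ≤ (Fintype.card P + d) * t := by
  classical
  apply Nat.sInf_le
  let h : P ⊕ Fin d → Fin t → Fin d := fun q i => Sum.elim (fun p => f i p) (fun a => a) q
  let g : P ⊕ Fin d → Finset (Σ _ : Fin t, Fin d) := fun q =>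
    (univ : Finset (Fin t)).image (fun i => (⟨i, h q i⟩ : Σ _ : Fin t, Fin d))
  have hg : ∀ q i a, (⟨i, a⟩ : Σ _ : Fin t, Fin d) ∈ g q ↔ h q i = a := by
    intro q i a
    simp only [g, mem_image, mem_univ, true_and]
    constructor
    · rintro ⟨j, hj⟩
      simp only [Sigma.mk.injEq, heq_eq_eq] at hj
      obtain ⟨rfl, h2⟩ := hj
      exact h2
    · rintro rfl
      exact ⟨i, rfl⟩
  refine ⟨(univ : Finset (P ⊕ Fin d)).val.map g, ?_, ?_, ?_⟩
  · intro c hc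
    simp only [Multiset.mem_map] at hc
    obtain ⟨q, -, rfl⟩ := hc
    rintro ⟨i, a⟩ hu ⟨j, b⟩ hv huv
    rw [Finset.mem_coe, hg] at hu hv
    subst hu hv
    change i ≠ j
    rintro rfl
    exact huv rfl
  · rintro ⟨i, a⟩ ⟨j, b⟩ huv
    change i ≠ j at huv
    by_cases hab : a = b
    · subst hab
      refine ⟨g (Sum.inr a), Multiset.mem_map_of_mem _ (mem_univ _), ?_, ?_⟩ <;>
      · rw [hg]; rfl
    · obtain ⟨p, hp1, hp2⟩ := hf i j huv a b hab
      refine ⟨g (Sum.inl p), Multiset.mem_map_of_mem _ (mem_univ _), ?_, ?_⟩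
      · rw [hg]; exact hp1
      · rw [hg]; exact hp2
  · rw [Multiset.map_map]
    change ∑ q : P ⊕ Fin d, (g q).card = _
    have : ∀ q, (g q).card = t := by
      intro q
      simp only [g]
      rw [card_image_of_injective]
      · simp
      · intro i j hij
        simp only [Sigma.mk.injEq] at hij
        exact hij.1
    simp [this]

/-! ### Lower bound -/

theorem pair_lower {t n : ℕ} (ht : 1 ≤ t) (A B : Fin t → Finset (Fin n))
    (hd : ∀ i, Disjoint (A i) (B i)) (hx : ∀ i j, i ≠ j → ¬ Disjoint (A i) (B j)) :
    (t : ℝ) * Real.logb 2 t ≤ ∑ i, (((A i).card : ℝ) + (B i).card) := by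
  classical
  have hcard : ∑ i, (Icc (A i) (B i)ᶜ).card ≤ 2 ^ n := by
    rw [← card_biUnion]
    · refine (card_le_univ _).trans ?_
      simp
    · intro i _ j _ hij
      rw [Function.onFun, Finset.disjoint_left]
      intro T hT1 hT2
      rw [Finset.mem_Icc] at hT1 hT2
      apply hx i j hij
      have h1 : A i ≤ (B j)ᶜ := hT1.1.trans hT2.2
      exact (le_compl_iff_disjoint_right).1 h1
  have hpt : ∀ i, ((Icc (A i) (B i)ᶜ).card : ℝ)
      = 2 ^ n * Real.exp (-(((A i).card : ℝ) + (B i).card) * Real.log 2) := by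
    intro i
    have hle : A i ≤ (B i)ᶜ := (le_compl_iff_disjoint_right).2 (hd i)
    rw [Finset.card_Icc_finset hle]
    have h2 : (B i)ᶜ.card - (A i).card + ((A i).card + (B i).card) = n := by
      have h3 := card_le_card hle
      have h4 := card_add_card_compl (B i)
      simp only [Fintype.card_fin] at h4
      omega
    have h5 : Real.exp (-(((A i).card : ℝ) + (B i).card) * Real.log 2)
        * 2 ^ ((A i).card + (B i).card) = 1 := by
      have : (2:ℝ) ^ ((A i).card + (B i).card)
          = Real.exp ((((A i).card : ℝ) + (B i).card) * Real.log 2) := by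
        have h6 := Real.exp_nat_mul (Real.log 2) ((A i).card + (B i).card)
        rw [Real.exp_log two_pos] at h6
        rw [← h6]; push_cast; rfl
      rw [this, ← Real.exp_add, neg_mul, neg_add_cancel, Real.exp_zero]
    generalize (B i)ᶜ.card - (A i).card = u at *
    have h9 : (2:ℝ) ^ n = 2 ^ u * 2 ^ ((A i).card + (B i).card) := by rw [← pow_add, h2]
    rw [h9, mul_assoc, mul_comm ((2:ℝ) ^ (_ + _)), h5]
    simp
  have hsum : ∑ i, Real.exp (-(((A i).card : ℝ) + (B i).card) * Real.log 2) ≤ 1 := by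
    have h1 : (∑ i, ((Icc (A i) (B i)ᶜ).card : ℝ)) ≤ 2 ^ n := by exact_mod_cast hcard
    rw [sum_congr rfl (fun i _ => hpt i), ← mul_sum] at h1
    have : (0:ℝ) < 2 ^ n := by positivity
    nlinarith
  have htpos : (0:ℝ) < t := by exact_mod_cast ht
  have hl2 : 0 < Real.log 2 := Real.log_pos one_lt_two
  have hi : ∀ i : Fin t, 1 + Real.log t - (((A i).card : ℝ) + (B i).card) * Real.log 2
      ≤ t * Real.exp (-(((A i).card : ℝ) + (B i).card) * Real.log 2) := by
    intro i
    have := Real.add_one_le_exp (Real.log t - (((A i).card : ℝ) + (B i).card) * Real.log 2)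
    rw [sub_eq_add_neg (Real.log t), Real.exp_add, Real.exp_log htpos, ← neg_mul] at this
    linarith
  have h7 := sum_le_sum (fun i (_ : i ∈ (univ : Finset (Fin t))) => hi i)
  rw [← mul_sum, sum_sub_distrib, ← sum_mul] at h7
  simp only [sum_const, card_univ, Fintype.card_fin, nsmul_eq_mul] at h7
  rw [Real.logb, mul_div_assoc', div_le_iff₀ hl2]
  nlinarith

theorem scc_set_nonempty {V : Type*} [Fintype V] (G : SimpleGraph V) :
    {w : ℕ | ∃ C : Multiset (Finset V),
    (∀ c ∈ C, G.IsClique (c : Set V)) ∧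
    (∀ u v : V, G.Adj u v → ∃ c ∈ C, u ∈ c ∧ v ∈ c) ∧
    (C.map Finset.card).sum = w}.Nonempty := by
  classical
  refine ⟨_, ((univ : Finset (Finset V)).filter (fun c : Finset V => G.IsClique (c : Set V))).val,
    ?_, ?_, rfl⟩
  · intro c hc
    rw [Finset.mem_val, mem_filter] at hc
    exact hc.2
  · intro u v huv
    refine ⟨{u, v}, ?_, by simp, by simp⟩
    rw [Finset.mem_val, mem_filter]
    refine ⟨mem_univ _, ?_⟩
    simp only [coe_insert, coe_singleton]
    rw [SimpleGraph.isClique_pair]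
    exact fun _ => huv

theorem scc_lower {t d : ℕ} (ht : 1 ≤ t) (hd : 2 ≤ d) :
    (d : ℝ) / 2 * (t * Real.logb 2 t) ≤ sigmaCliqueCover (Ktd t d) := by
  classical
  obtain ⟨C, hC1, hC2, hC3⟩ := Nat.sInf_mem (scc_set_nonempty (Ktd t d))
  change _ = sigmaCliqueCover (Ktd t d) at hC3
  rw [← hC3]
  obtain ⟨l, rfl⟩ : ∃ l : List (Finset (Σ _ : Fin t, Fin d)), C = l := ⟨C.toList, by simp⟩
  let S : Fin t → Fin d → Finset (Fin l.length) := fun i a =>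
    univ.filter (fun k => (⟨i, a⟩ : Σ _ : Fin t, Fin d) ∈ l.get k)
  have hw : (Multiset.map Finset.card (l : Multiset (Finset (Σ _ : Fin t, Fin d)))).sum
      = ∑ a, ∑ i, (S i a).card := by
    have h1 : (Multiset.map Finset.card (l : Multiset (Finset (Σ _ : Fin t, Fin d)))).sum
        = ∑ k : Fin l.length, (l.get k).card := by
      simp only [Multiset.map_coe, Multiset.sum_coe, List.get_eq_getElem]
      rw [Fin.sum_univ_fun_getElem]
    rw [h1, sum_comm]
    have h2 : ∀ k : Fin l.length, (l.get k).card
        = ∑ i : Fin t, ∑ a : Fin d, if (⟨i, a⟩ : Σ _ : Fin t, Fin d) ∈ l.get k then 1 else 0 := by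
      intro k
      rw [← Fintype.sum_sigma' (fun (i : Fin t) (a : Fin d) =>
        if (⟨i, a⟩ : Σ _ : Fin t, Fin d) ∈ l.get k then 1 else 0)]
      rw [Finset.card_eq_sum_ones, ← Finset.sum_filter]
      congr 1
      ext x; simp
    rw [sum_congr rfl (fun k _ => h2 k), sum_comm]
    refine sum_congr rfl (fun i _ => ?_)
    rw [sum_comm]
    refine sum_congr rfl (fun a _ => ?_)
    simp only [S, card_filter]
  rw [hw]
  have : NeZero d := ⟨by omega⟩
  have hpair : ∀ a b : Fin d, a ≠ b → (t : ℝ) * Real.logb 2 t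
      ≤ ∑ i, ((S i a).card : ℝ) + ∑ i, ((S i b).card : ℝ) := by
    intro a b hab
    rw [← sum_add_distrib]
    apply pair_lower ht (fun i => S i a) (fun i => S i b)
    · intro i
      rw [Finset.disjoint_left]
      intro k h1 h2
      simp only [S, mem_filter, mem_univ, true_and] at h1 h2
      have h3 := hC1 (l.get k) (by simp) (Finset.mem_coe.2 h1) (Finset.mem_coe.2 h2)
        (by simp [hab])
      change i ≠ i at h3
      exact h3 rfl
    · intro i j hij
      obtain ⟨c, hc, h1, h2⟩ := hC2 ⟨i, a⟩ ⟨j, b⟩ hij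
      rw [Multiset.mem_coe] at hc
      obtain ⟨k, rfl⟩ := List.get_of_mem hc
      rw [Finset.not_disjoint_iff]
      exact ⟨k, by simpa [S] using h1, by simpa [S] using h2⟩
  have hsucc : ∀ a : Fin d, a ≠ a + 1 := by
    intro a h
    have h1 : (1 : Fin d) = 0 := by simpa using h.symm
    have h2 := congrArg Fin.val h1
    rw [Fin.val_one', Nat.mod_eq_of_lt (by omega)] at h2
    simp at h2
  have hs := sum_le_sum (fun a (_ : a ∈ (univ : Finset (Fin d))) => hpair a (a + 1) (hsucc a))
  rw [sum_add_distrib] at hs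
  have h8 : ∑ a : Fin d, ∑ i, ((S i (a + 1)).card : ℝ) = ∑ a : Fin d, ∑ i, ((S i a).card : ℝ) :=
    Equiv.sum_comp (Equiv.addRight (1 : Fin d)) (fun a => ∑ i, ((S i a).card : ℝ))
  rw [h8] at hs
  simp only [sum_const, card_univ, Fintype.card_fin, nsmul_eq_mul] at hs
  push_cast
  linarith

/-! ### Combining colourings -/

theorem chain_lemma {A Y : Type*} [AddCommGroup A] (c₁ c₂ : Y → A) (k : ℕ) :
    ∃ D : (Fin k → Y) → (Fin (k + 1) → A), ∀ x y, x ≠ y → D x = D y →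
      (∃ i, x i ≠ y i ∧ c₁ (x i) = c₁ (y i)) ∧ (∃ i, x i ≠ y i ∧ c₂ (x i) = c₂ (y i)) := by
  classical
  refine ⟨fun x j => (if h : j.1 < k then c₁ (x ⟨j.1, h⟩) else 0) -
    (if h : 0 < j.1 then c₂ (x ⟨j.1 - 1, by omega⟩) else 0), ?_⟩
  intro x y hxy hD
  have hD' := fun j => congrFun hD j
  simp only at hD'
  have hne : (univ.filter (fun i => x i ≠ y i)).Nonempty := by
    obtain ⟨i, hi⟩ := Function.ne_iff.1 hxy
    exact ⟨i, by simpa using hi⟩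
  constructor
  · obtain ⟨i, hi, hmin⟩ := Finset.exists_minimal hne
    simp only [mem_filter, mem_univ, true_and] at hi hmin
    refine ⟨i, hi, ?_⟩
    have h := hD' ⟨i.1, by omega⟩
    simp only [i.2, dif_pos] at h
    by_cases h0 : 0 < i.1
    · simp only [h0, dif_pos] at h
      have hp : x ⟨i.1 - 1, by omega⟩ = y ⟨i.1 - 1, by omega⟩ := by
        by_contra hc
        have := hmin hc (by rw [Fin.le_def]; simp)
        rw [Fin.le_def] at this
        simp only at this
        omega
      rw [hp] at h
      exact sub_left_injective h
    · simpa [h0] using h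
  · obtain ⟨i, hi, hmax⟩ := Finset.exists_maximal hne
    simp only [mem_filter, mem_univ, true_and] at hi hmax
    refine ⟨i, hi, ?_⟩
    have h := hD' ⟨i.1 + 1, by omega⟩
    simp only [Nat.succ_pos, dif_pos, Nat.add_sub_cancel] at h
    by_cases h0 : i.1 + 1 < k
    · simp only [h0, dif_pos] at h
      have hp : x ⟨i.1 + 1, h0⟩ = y ⟨i.1 + 1, h0⟩ := by
        by_contra hc
        have := hmax hc (by rw [Fin.le_def]; simp)
        rw [Fin.le_def] at this
        simp only at this
        omega
      rw [hp] at h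
      exact sub_right_injective h
    · simpa [h0] using h

theorem combine {X E : Type} [DecidableEq E] {N : ℕ} (hN : 1 ≤ N)
    (r : E → X → X → Prop) (c : E → X → Fin N)
    (hc : ∀ e x y, x ≠ y → c e x = c e y → r e x y) {k : ℕ} (S : Finset E) :
    ∃ (ι : Type) (_ : Fintype ι), Fintype.card ι = k ^ S.card ∧
      ∃ C : (ι → X) → Fin (N ^ ((k + 1) ^ S.card)), ∀ x y, x ≠ y → C x = C y →
        ∀ e ∈ S, ∃ i, r e (x i) (y i) := by
  classical
  induction S using Finset.induction_on with
  | empty =>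
    refine ⟨Unit, inferInstance, by simp, fun _ => ⟨0, by simp; omega⟩, ?_⟩
    intro x y _ _ e he
    simp at he
  | insert e S he ih =>
    obtain ⟨ι, hι, hcard, C, hC⟩ := ih
    rw [card_insert_of_notMem he]
    generalize hM : N ^ ((k + 1) ^ S.card) = M at C hC
    have hM1 : 1 ≤ M := hM ▸ Nat.one_le_pow _ _ hN
    have : NeZero M := ⟨by omega⟩
    have hle : Fintype.card (ι → Fin N) ≤ Fintype.card (Fin M) := by
      simp only [Fintype.card_fun, Fintype.card_fin, hcard, ← hM]
      exact Nat.pow_le_pow_right hN (Nat.pow_le_pow_left (by omega) _)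
    obtain ⟨emb⟩ := Function.Embedding.nonempty_of_card_le hle
    let c₂ : (ι → X) → Fin M := fun x => emb (fun i => c e (x i))
    have hc₂ : ∀ x y, x ≠ y → c₂ x = c₂ y → ∃ i, r e (x i) (y i) := by
      intro x y hxy h
      have h1 := emb.injective h
      obtain ⟨i, hi⟩ := Function.ne_iff.1 hxy
      exact ⟨i, hc e _ _ hi (congrFun h1 i)⟩
    obtain ⟨D, hD⟩ := chain_lemma (A := Fin M) C c₂ k
    have hcardD : Fintype.card (Fin (k + 1) → Fin M) = N ^ ((k + 1) ^ (S.card + 1)) := by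
      simp only [Fintype.card_fun, Fintype.card_fin, ← hM]
      rw [← pow_mul, pow_succ]
    refine ⟨Fin k × ι, inferInstance, ?_,
      fun x => Fintype.equivFinOfCardEq hcardD (D (fun j i => x (j, i))), ?_⟩
    · rw [Fintype.card_prod, hcard, Fintype.card_fin, pow_succ, mul_comm]
    · intro x y hxy h
      have h1 := (Equiv.injective _) h
      have hne : (fun (j : Fin k) (i : ι) => x (j, i)) ≠ (fun j i => y (j, i)) := by
        intro h2
        apply hxy
        ext ⟨j, i⟩
        exact congrFun (congrFun h2 j) i
      obtain ⟨⟨j1, hj1, hj1'⟩, ⟨j2, hj2, hj2'⟩⟩ := hD _ _ hne h1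
      intro e' he'
      rw [mem_insert] at he'
      rcases he' with rfl | he'
      · obtain ⟨i, hi⟩ := hc₂ _ _ hj2 hj2'
        exact ⟨(j2, i), hi⟩
      · obtain ⟨i, hi⟩ := hC _ _ hj1 hj1' e' he'
        exact ⟨(j1, i), hi⟩

/-! ### Balanced words -/

/-- Words in which every letter occurs exactly `s` times. -/
abbrev BalWord (d s : ℕ) : Type :=
  {x : Fin d × Fin s → Fin d // ∀ a, (univ.filter (fun p => x p = a)).card = s}

/-- Replace the letter `b` by `a`. -/
def mergeWord {d s : ℕ} (a b : Fin d) (x : BalWord d s) : Fin d × Fin s → Fin d :=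
  fun p => if x.1 p = b then a else x.1 p

theorem merge_sep {d s : ℕ} {a b : Fin d} (x y : BalWord d s) (hxy : x ≠ y)
    (h : mergeWord a b x = mergeWord a b y) : ∃ p, x.1 p = a ∧ y.1 p = b := by
  classical
  by_contra hcon
  push Not at hcon
  have hm : ∀ p, (if x.1 p = b then a else x.1 p) = (if y.1 p = b then a else y.1 p) :=
    fun p => congrFun h p
  have hsub : univ.filter (fun p => x.1 p = a) ⊆ univ.filter (fun p => y.1 p = a) := by
    intro p hp
    simp only [mem_filter, mem_univ, true_and] at hp ⊢
    have h1 := hm p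
    have h2 := hcon p hp
    rw [if_neg h2] at h1
    rw [← h1, hp]
    simp
  have heq := eq_of_subset_of_card_le hsub (by rw [x.2 a, y.2 a])
  have hiff : ∀ p, x.1 p = a ↔ y.1 p = a := by
    intro p
    have : p ∈ univ.filter (fun p => x.1 p = a) ↔ p ∈ univ.filter (fun p => y.1 p = a) := by
      rw [heq]
    simpa using this
  apply hxy
  apply Subtype.ext
  funext p
  have h1 := hm p
  have h2 := hcon p
  have h3 := hiff p
  split_ifs at h1 with h4 h5 h5
  · rw [h4, h5]
  · rw [h3.2 h1.symm, ← h1]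
  · exact absurd h5 (h2 h1)
  · exact h1

theorem merge_fiber {d s : ℕ} {a b : Fin d} (hab : a ≠ b) (x : BalWord d s) :
    s.centralBinom ≤
      (univ.filter (fun y : BalWord d s => mergeWord a b y = mergeWord a b x)).card := by
  classical
  let U : Finset (Fin d × Fin s) := univ.filter (fun p => x.1 p = a ∨ x.1 p = b)
  have hU : U.card = 2 * s := by
    have : U = univ.filter (fun p => x.1 p = a) ∪ univ.filter (fun p => x.1 p = b) := by
      ext p; simp [U]
    rw [this, card_union_of_disjoint, x.2, x.2]
    · ring
    · rw [Finset.disjoint_left]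
      intro p h1 h2
      simp only [mem_filter, mem_univ, true_and] at h1 h2
      exact hab (h1.symm.trans h2)
  have hmemU : ∀ p, p ∈ U ↔ (x.1 p = a ∨ x.1 p = b) := by intro p; simp [U]
  let w : Finset (Fin d × Fin s) → Fin d × Fin s → Fin d :=
    fun T p => if p ∈ T then a else if p ∈ U then b else x.1 p
  have hw : ∀ T ∈ powersetCard s U, ∀ c, (univ.filter (fun p => w T p = c)).card = s := by
    intro T hT c
    rw [mem_powersetCard] at hT
    by_cases hca : c = a
    · subst hca
      have : univ.filter (fun p => w T p = c) = T := by
        ext p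
        simp only [mem_filter, mem_univ, true_and, w]
        have := hmemU p
        grind
      rw [this, hT.2]
    · by_cases hcb : c = b
      · subst hcb
        have : univ.filter (fun p => w T p = c) = U \ T := by
          ext p
          simp only [mem_filter, mem_univ, true_and, w, mem_sdiff]
          have := hmemU p
          grind
        rw [this, card_sdiff_of_subset hT.1, hU, hT.2]
        omega
      · refine Eq.trans ?_ (x.2 c)
        congr 1
        ext p
        simp only [mem_filter, mem_univ, true_and, w]
        have := hmemU p
        have := @hT.1 p
        grind
  have hcard : (powersetCard s U).attach.card = s.centralBinom := by
    rw [card_attach, card_powersetCard, hU, Nat.centralBinom]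
  rw [← hcard]
  refine card_le_card_of_injOn (fun T => (⟨w T.1, hw T.1 T.2⟩ : BalWord d s)) ?_ ?_
  · intro T _
    have hT := (mem_powersetCard.1 T.2).1
    simp only [coe_filter, mem_univ, true_and, Set.mem_ofPred_eq]
    funext p
    simp only [mergeWord, w]
    have := hmemU p
    have := @hT p
    grind
  · intro T _ T' _ h
    have h1 : w T.1 = w T'.1 := congrArg Subtype.val h
    apply Subtype.ext
    ext p
    have h2 := congrFun h1 p
    have hT := @(mem_powersetCard.1 T.2).1 p
    have hT' := @(mem_powersetCard.1 T'.2).1 p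
    simp only [w] at h2
    grind

theorem balWord_nonempty (d s : ℕ) : Nonempty (BalWord d s) := by
  classical
  refine ⟨⟨Prod.fst, ?_⟩⟩
  intro a
  have : univ.filter (fun p : Fin d × Fin s => p.1 = a)
      = (univ : Finset (Fin s)).image (fun j => (a, j)) := by
    ext ⟨i, j⟩
    simp [eq_comm]
  rw [this, card_image_of_injective _ (fun i j h => by simpa using h)]
  simp

theorem merge_image {d s : ℕ} {a b : Fin d} (hab : a ≠ b) :
    ((univ : Finset (BalWord d s)).image (mergeWord a b)).card * s.centralBinom
      ≤ Fintype.card (BalWord d s) := by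
  classical
  rw [← card_univ (α := BalWord d s)]
  rw [card_eq_sum_card_image (mergeWord a b) (univ : Finset (BalWord d s))]
  rw [← smul_eq_mul]
  apply card_nsmul_le_sum
  intro z hz
  obtain ⟨x, -, rfl⟩ := mem_image.1 hz
  exact merge_fiber hab x

theorem exists_codes {d : ℕ} (hd : 2 ≤ d) (s : ℕ) :
    ∃ E N : ℕ, 1 ≤ N ∧ ∀ k : ℕ, ∃ (P W : Type) (_ : Fintype P) (_ : Fintype W)
      (f : W → P → Fin d), IsGoodCode f ∧ Fintype.card P = k ^ E * (d * s) ∧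
      (s.centralBinom * N) ^ (k ^ E) ≤ Fintype.card W * N ^ ((k + 1) ^ E) := by
  classical
  let X := BalWord d s
  let E := {e : Fin d × Fin d // e.1 ≠ e.2}
  have hwpos : 0 < s.centralBinom := Nat.centralBinom_pos s
  let N := Fintype.card X / s.centralBinom
  have himg : ∀ e : E, ((univ : Finset X).image (mergeWord e.1.1 e.1.2)).card ≤ N := by
    intro e
    rw [Nat.le_div_iff_mul_le hwpos]
    exact merge_image e.2
  have hN : 1 ≤ N := by
    refine le_trans ?_ (himg ⟨(⟨0, by omega⟩, ⟨1, by omega⟩), by simp⟩)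
    rw [Nat.one_le_iff_ne_zero, Ne, card_eq_zero, image_eq_empty]
    obtain ⟨x⟩ := balWord_nonempty d s
    exact ne_empty_of_mem (mem_univ (x : X))
  have hcol : ∀ e : E, ∃ c : X → Fin N, ∀ x y, x ≠ y → c x = c y →
      ∃ p, x.1 p = e.1.1 ∧ y.1 p = e.1.2 := by
    intro e
    have h1 : Fintype.card ((univ : Finset X).image (mergeWord e.1.1 e.1.2))
        ≤ Fintype.card (Fin N) := by
      rw [Fintype.card_coe, Fintype.card_fin]
      exact himg e
    obtain ⟨emb⟩ := Function.Embedding.nonempty_of_card_le h1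
    refine ⟨fun x => emb ⟨mergeWord e.1.1 e.1.2 x, mem_image_of_mem _ (mem_univ _)⟩, ?_⟩
    intro x y hxy h
    have h2 := congrArg Subtype.val (emb.injective h)
    exact merge_sep x y hxy h2
  choose c hc using hcol
  refine ⟨(univ : Finset E).card, N, hN, ?_⟩
  intro k
  obtain ⟨ι, hι, hcard, C, hC⟩ := combine (X := X) hN
    (fun (e : E) x y => ∃ p, x.1 p = e.1.1 ∧ y.1 p = e.1.2) c hc (k := k) univ
  have hNpos : 0 < N ^ (k + 1) ^ (univ : Finset E).card := Nat.pow_pos hN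
  have : Nonempty (Fin (N ^ (k + 1) ^ (univ : Finset E).card)) := ⟨⟨0, hNpos⟩⟩
  -- the largest colour class
  obtain ⟨z, -, hz⟩ := exists_max_image (univ : Finset (Fin (N ^ (k + 1) ^ (univ : Finset E).card)))
    (fun z => (univ.filter (fun x => C x = z)).card) univ_nonempty
  have htot : Fintype.card (ι → X) ≤
      (univ.filter (fun x => C x = z)).card * N ^ (k + 1) ^ (univ : Finset E).card := by
    rw [← card_univ, card_eq_sum_card_fiberwise (f := C) (t := univ) (fun x _ => mem_univ _)]
    refine (sum_le_card_nsmul _ _ _ hz).trans ?_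
    rw [smul_eq_mul, card_univ, Fintype.card_fin, mul_comm]
  refine ⟨ι × (Fin d × Fin s), {x : ι → X // C x = z}, inferInstance, inferInstance,
    fun x p => (x.1 p.1).1 p.2, ?_, ?_, ?_⟩
  · intro x y hxy a b hab
    obtain ⟨i, p, hp⟩ := hC x.1 y.1 (fun h => hxy (Subtype.ext h)) (x.2.trans y.2.symm)
      ⟨(a, b), hab⟩ (mem_univ _)
    exact ⟨(i, p), hp⟩
  · simp only [Fintype.card_prod, hcard, Fintype.card_fin]
  · rw [Fintype.card_subtype]
    refine le_trans ?_ htot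
    rw [Fintype.card_fun, hcard]
    apply Nat.pow_le_pow_left
    exact Nat.mul_div_le _ _

theorem scc_upper {d t L : ℕ} {P W : Type} [Fintype P] [Fintype W] (f : W → P → Fin d)
    (hf : IsGoodCode f) (ht : t ≤ Fintype.card W ^ L) :
    sigmaCliqueCover (Ktd t d) ≤ (L * Fintype.card P + d) * t := by
  classical
  have h1 : Fintype.card (Fin t) ≤ Fintype.card (Fin L → W) := by simpa using ht
  obtain ⟨emb⟩ := Function.Embedding.nonempty_of_card_le h1
  have h2 := scc_le_of_code (t := t) (d := d) (P := Fin L × P)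
    (fun i p => f (emb i p.1) p.2) ?_
  · simpa using h2
  · intro i j hij a b hab
    have h3 : emb i ≠ emb j := fun h => hij (emb.injective h)
    obtain ⟨l, hl⟩ := Function.ne_iff.1 h3
    obtain ⟨p, hp⟩ := hf _ _ hl a b hab
    exact ⟨(l, p), hp⟩

open Filter Topology in
theorem exists_s_s2 (d : ℕ) (ε : ℝ) (hε : 0 < ε) :
    ∃ s : ℕ, (d : ℝ) * s < ((d : ℝ) / 2 + ε) * Real.logb 2 s.centralBinom := by
  have hl2 : 0 < Real.log 2 := Real.log_pos one_lt_two
  have hlim : Tendsto (fun s : ℕ => Real.log (2 * s : ℝ) / (2 * s : ℝ)) atTop (𝓝 0) := by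
    have h1 : Tendsto (fun x : ℝ => Real.log x / x) atTop (𝓝 0) :=
      Real.isLittleO_log_id_atTop.tendsto_div_nhds_zero
    exact h1.comp (tendsto_natCast_atTop_atTop.const_mul_atTop two_pos)
  have hc : 0 < (d : ℝ) / 2 + ε := by positivity
  have hev := hlim.eventually (gt_mem_nhds (show (0:ℝ) < ε * Real.log 2 / ((d : ℝ) / 2 + ε) by
    positivity))
  obtain ⟨s, hs, hs1⟩ := (hev.and (eventually_ge_atTop 1)).exists
  refine ⟨s, ?_⟩
  have hspos : (0:ℝ) < s := by exact_mod_cast hs1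
  have hb := Nat.four_pow_le_two_mul_self_mul_centralBinom s hs1
  have hb' : (4:ℝ) ^ s ≤ 2 * s * s.centralBinom := by exact_mod_cast hb
  have hwpos : (0:ℝ) < s.centralBinom := by exact_mod_cast Nat.centralBinom_pos s
  have hlog := Real.log_le_log (by positivity) hb'
  rw [Real.log_pow, Real.log_mul (by positivity) hwpos.ne',
    show (4:ℝ) = 2 ^ 2 by norm_num, Real.log_pow] at hlog
  rw [div_lt_div_iff₀ (by positivity) hc] at hs
  rw [Real.logb, mul_div_assoc', lt_div_iff₀ hl2]
  push_cast at hlog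
  nlinarith

open Filter Topology in
theorem exists_good_rate {d : ℕ} (hd : 2 ≤ d) (ε : ℝ) (hε : 0 < ε) :
    ∃ (P W : Type) (_ : Fintype P) (_ : Fintype W) (f : W → P → Fin d), IsGoodCode f ∧
      (Fintype.card P : ℝ) < ((d : ℝ) / 2 + ε) * Real.logb 2 (Fintype.card W) := by
  obtain ⟨s, hs⟩ := exists_s_s2 d ε hε
  obtain ⟨E, N, hN, hcodes⟩ := exists_codes hd s
  have hNpos : (0:ℝ) < N := by exact_mod_cast hN
  have hwpos : (0:ℝ) < s.centralBinom := by exact_mod_cast Nat.centralBinom_pos s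
  have hlim : Tendsto (fun k : ℕ => ((d : ℝ) / 2 + ε) * (Real.logb 2 s.centralBinom
      - ((1 + 1 / (k : ℝ)) ^ E - 1) * Real.logb 2 N)) atTop
      (𝓝 (((d : ℝ) / 2 + ε) * (Real.logb 2 s.centralBinom
      - ((1 + 0) ^ E - 1) * Real.logb 2 N))) := by
    refine Tendsto.const_mul _ (Tendsto.const_sub _ (Tendsto.mul_const _ (Tendsto.sub_const
      (Tendsto.pow (Tendsto.const_add _ ?_) _) _)))
    exact tendsto_one_div_atTop_nhds_zero_nat
  simp only [add_zero, one_pow, sub_self, zero_mul, sub_zero] at hlim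
  obtain ⟨k, hk, hk1⟩ := ((hlim.eventually (lt_mem_nhds hs)).and (eventually_ge_atTop 1)).exists
  obtain ⟨P, W, hP, hW, f, hf, hcP, hcW⟩ := hcodes k
  refine ⟨P, W, hP, hW, f, hf, ?_⟩
  have hkpos : (0:ℝ) < k := by exact_mod_cast hk1
  have hKpos : (0:ℝ) < (k:ℝ) ^ E := by positivity
  have hcW' : ((s.centralBinom : ℝ) * N) ^ (k ^ E) ≤ Fintype.card W * (N:ℝ) ^ ((k + 1) ^ E) := by
    exact_mod_cast hcW
  have hWpos : (0:ℝ) < Fintype.card W := by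
    by_contra hcon
    have h0 : (0:ℝ) < ((s.centralBinom : ℝ) * N) ^ (k ^ E) := by positivity
    have h1 : (0:ℝ) < (N:ℝ) ^ ((k + 1) ^ E) := by positivity
    nlinarith
  have hlog := Real.logb_le_logb_of_le one_lt_two (by positivity) hcW'
  rw [Real.logb_pow, Real.logb_mul hwpos.ne' hNpos.ne', Real.logb_mul hWpos.ne' (by positivity),
    Real.logb_pow] at hlog
  push_cast at hlog
  have hexp : ((k:ℝ) + 1) ^ E = (k:ℝ) ^ E * (1 + 1 / (k : ℝ)) ^ E := by
    rw [← mul_pow]; congr 1; field_simp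
  rw [hexp] at hlog
  have h2 : (k:ℝ) ^ E * (Real.logb 2 s.centralBinom
      - ((1 + 1 / (k : ℝ)) ^ E - 1) * Real.logb 2 N) ≤ Real.logb 2 (Fintype.card W) := by
    linarith
  rw [hcP]
  push_cast
  have hc : 0 < (d : ℝ) / 2 + ε := by positivity
  calc (k:ℝ) ^ E * (d * s) < (k:ℝ) ^ E * (((d : ℝ) / 2 + ε) * (Real.logb 2 s.centralBinom
      - ((1 + 1 / (k : ℝ)) ^ E - 1) * Real.logb 2 N)) := mul_lt_mul_of_pos_left hk hKpos
    _ = ((d : ℝ) / 2 + ε) * ((k:ℝ) ^ E * (Real.logb 2 s.centralBinom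
      - ((1 + 1 / (k : ℝ)) ^ E - 1) * Real.logb 2 N)) := by ring
    _ ≤ _ := mul_le_mul_of_nonneg_left h2 hc.le

/-- **Theorem.** For every fixed `d ≥ 2`,
`lim_{t → ∞} scc(K_t(d)) / (t log₂ t) = d / 2`. -/
theorem stmt2 (d : ℕ) (hd : 2 ≤ d) :
    Filter.Tendsto
      (fun t : ℕ => (sigmaCliqueCover (Ktd t d) : ℝ) / (t * Real.logb 2 t))
      Filter.atTop (nhds ((d : ℝ) / 2)) := by
  have hlogpos : ∀ t : ℕ, 2 ≤ t → 0 < Real.logb 2 (t : ℝ) := by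
    intro t ht
    apply Real.logb_pos one_lt_two
    exact_mod_cast ht
  rw [tendsto_order]
  constructor
  · intro a ha
    filter_upwards [Filter.eventually_ge_atTop 2] with t ht
    refine lt_of_lt_of_le ha ?_
    have hl := hlogpos t ht
    have htpos : (0:ℝ) < t := by exact_mod_cast (by omega : 0 < t)
    rw [le_div_iff₀ (by positivity)]
    exact scc_lower (by omega) hd
  · intro b hb
    obtain ⟨P, W, _, _, f, hf, hrate⟩ := exists_good_rate hd (b - d / 2) (by linarith)
    have hbpos : 0 < b := lt_of_le_of_lt (by positivity) hb
    rw [add_sub_cancel] at hrate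
    have hq : 0 < Real.logb 2 (Fintype.card W) := by
      have : (0:ℝ) ≤ Fintype.card P := by positivity
      by_contra hcon
      nlinarith
    generalize hql : Real.logb 2 (Fintype.card W) = lq at *
    have hWpos : (0:ℝ) < Fintype.card W := by
      rcases Nat.eq_zero_or_pos (Fintype.card W) with h | h
      · rw [h] at hql
        simp at hql
        linarith
      · exact_mod_cast h
    have hdiv : (Fintype.card P : ℝ) / lq < b := by
      rw [div_lt_iff₀ hq]; exact hrate
    have hlim : Filter.Tendsto (fun t : ℕ => (Fintype.card P : ℝ) / lq +
        (Fintype.card P + d) / Real.logb 2 (t : ℝ)) Filter.atTop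
        (nhds ((Fintype.card P : ℝ) / lq + 0)) := by
      refine Filter.Tendsto.const_add _ (Filter.Tendsto.const_div_atTop ?_ _)
      exact (Real.tendsto_logb_atTop one_lt_two).comp tendsto_natCast_atTop_atTop
    rw [add_zero] at hlim
    filter_upwards [Filter.eventually_ge_atTop 2, hlim.eventually (gt_mem_nhds hdiv)]
      with t ht htb
    refine lt_of_le_of_lt ?_ htb
    have hl := hlogpos t ht
    have htpos : (0:ℝ) < t := by exact_mod_cast (by omega : 0 < t)
    have hL1 : Real.logb 2 (t : ℝ) / lq ≤ ⌈Real.logb 2 (t : ℝ) / lq⌉₊ := Nat.le_ceil _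
    have hL2 := (Nat.ceil_lt_add_one (show 0 ≤ Real.logb 2 (t : ℝ) / lq by positivity)).le
    generalize ⌈Real.logb 2 (t : ℝ) / lq⌉₊ = L at *
    have htL : t ≤ Fintype.card W ^ L := by
      have h1 : Real.logb 2 (t : ℝ) ≤ Real.logb 2 ((Fintype.card W : ℝ) ^ L) := by
        rw [Real.logb_pow, hql]
        rwa [div_le_iff₀ hq] at hL1
      rw [Real.logb_le_logb one_lt_two htpos (by positivity)] at h1
      exact_mod_cast h1
    have hup := scc_upper f hf htL
    have hup' : (sigmaCliqueCover (Ktd t d) : ℝ) ≤ (L * Fintype.card P + d) * t := by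
      exact_mod_cast hup
    rw [div_le_iff₀ (by positivity)]
    refine hup'.trans ?_
    have h3 : (L : ℝ) * Fintype.card P ≤ (Real.logb 2 (t : ℝ) / lq + 1) * Fintype.card P :=
      mul_le_mul_of_nonneg_right hL2 (by positivity)
    have h4 : ((Fintype.card P : ℝ) / lq + (Fintype.card P + d) / Real.logb 2 (t : ℝ))
        * (t * Real.logb 2 (t : ℝ))
        = ((Real.logb 2 (t : ℝ) / lq + 1) * Fintype.card P + d) * t := by
      field_simp
      ring
    rw [h4]
    apply mul_le_mul_of_nonneg_right _ htpos.le
    linarith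
end

section
/- For every integer $d \ge 2$ and every real $\epsilon > 0$ there exists $t_0$ such that for every integer $t \ge t_0$ the sigma clique cover number of the complete $t$-partite graph with all parts of size $d$ satisfies $scc(K_t(d)) \le \left(\tfrac{1}{2} + \epsilon\right) d\, t \log_2 t$. -/
/-- Chain trick: merge two colourings of blocks, via first and last difference. -/
lemma scc_chain {B K : Type} [AddCommGroup K] (N : ℕ) (c1 c2 : B → K) :
    ∃ Φ : (Fin N → B) → (Fin (N + 1) → K), ∀ z w : Fin N → B, z ≠ w → Φ z = Φ w →
      (∃ k, z k ≠ w k ∧ c1 (z k) = c1 (w k)) ∧ (∃ k, z k ≠ w k ∧ c2 (z k) = c2 (w k)) := by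
  classical
  refine ⟨fun z j => (if h : j.val < N then c1 (z ⟨j.val, h⟩) else 0) -
    (if h : 0 < j.val then c2 (z ⟨j.val - 1, by omega⟩) else 0), ?_⟩
  intro z w hne heq
  have hex : (Finset.univ.filter (fun k => z k ≠ w k)).Nonempty := by
    obtain ⟨k, hk⟩ := Function.ne_iff.mp hne
    exact ⟨k, by simpa using hk⟩
  constructor
  · obtain ⟨k, hk, hmin⟩ := Finset.exists_min_image _ (fun k : Fin N => k.val) hex
    simp only [Finset.mem_filter, Finset.mem_univ, true_and] at hk hmin
    refine ⟨k, hk, ?_⟩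
    have h := congrFun heq ⟨k.val, by omega⟩
    simp only [k.isLt, dif_pos] at h
    by_cases h0 : 0 < k.val
    · have : z ⟨k.val - 1, by omega⟩ = w ⟨k.val - 1, by omega⟩ := by
        by_contra hc
        have := hmin _ hc
        simp only at this
        omega
      simp only [h0, dif_pos, this] at h
      exact sub_left_injective h
    · simpa [h0] using h
  · obtain ⟨k, hk, hmax⟩ := Finset.exists_max_image _ (fun k : Fin N => k.val) hex
    simp only [Finset.mem_filter, Finset.mem_univ, true_and] at hk hmax
    refine ⟨k, hk, ?_⟩
    have h := congrFun heq ⟨k.val + 1, by omega⟩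
    simp only [Nat.succ_pos, dif_pos, Nat.add_sub_cancel] at h
    by_cases h0 : k.val + 1 < N
    · have : z ⟨k.val + 1, h0⟩ = w ⟨k.val + 1, h0⟩ := by
        by_contra hc
        have := hmax _ hc
        simp only at this
        omega
      simp only [h0, dif_pos, this] at h
      exact sub_right_injective h
    · simpa [h0] using h

lemma scc_colour {T P : Type} [DecidableEq P] (M N : ℕ) (hM : 0 < M)
    (sep : P → T → T → Prop) (S : Finset P)
    (h : ∀ p ∈ S, ∃ c : T → Fin M, ∀ x y, x ≠ y → c x = c y → sep p x y) :
    ∃ (ι : Type) (_ : Fintype ι) (c : (ι → T) → ZMod (M ^ ((N + 1) ^ S.card))),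
      Fintype.card ι = N ^ S.card ∧
      ∀ x y, x ≠ y → c x = c y → ∀ p ∈ S, ∃ i, sep p (x i) (y i) := by
  classical
  induction S using Finset.induction_on with
  | empty => exact ⟨Unit, inferInstance, fun _ => 0, by simp, by simp⟩
  | insert p S hp ih =>
    set e := (N + 1) ^ S.card with he
    obtain ⟨ι, _, c1, hcard, hc1⟩ := ih (fun q hq => h q (Finset.mem_insert_of_mem hq))
    obtain ⟨cp, hcp⟩ := h p (Finset.mem_insert_self _ _)
    rw [Finset.card_insert_of_notMem hp]
    have : NeZero (M ^ e) := ⟨(pow_pos hM _).ne'⟩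
    have : NeZero (M ^ ((N + 1) ^ (S.card + 1))) := ⟨(pow_pos hM _).ne'⟩
    have hemb : Nonempty ((ι → Fin M) ↪ ZMod (M ^ e)) := by
      apply Function.Embedding.nonempty_of_card_le
      rw [ZMod.card, Fintype.card_fun, Fintype.card_fin, hcard]
      exact Nat.pow_le_pow_right hM (Nat.pow_le_pow_left (Nat.le_succ _) _)
    obtain ⟨em⟩ := hemb
    have hemb' : Nonempty ((Fin (N + 1) → ZMod (M ^ e)) ↪ ZMod (M ^ ((N + 1) ^ (S.card + 1)))) := by
      apply Function.Embedding.nonempty_of_card_le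
      rw [ZMod.card, Fintype.card_fun, Fintype.card_fin, ZMod.card, ← pow_mul, he, pow_succ]
    obtain ⟨em'⟩ := hemb'
    obtain ⟨Φ, hΦ⟩ := scc_chain N c1 (fun b : ι → T => em (fun i => cp (b i)))
    refine ⟨Fin N × ι, inferInstance, fun x => em' (Φ (fun j i => x (j, i))), ?_, ?_⟩
    · rw [Fintype.card_prod, Fintype.card_fin, hcard, pow_succ, mul_comm]
    · intro x y hne heq q hq
      have hne' : (fun (j : Fin N) (i : ι) => x (j, i)) ≠ (fun j i => y (j, i)) := by
        intro hc
        apply hne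
        funext ⟨j, i⟩
        exact congrFun (congrFun hc j) i
      obtain ⟨⟨k, hk, hk1⟩, ⟨l, hl, hl1⟩⟩ := hΦ _ _ hne' (em'.injective heq)
      rcases Finset.mem_insert.mp hq with rfl | hq
      · have h2 := em.injective hl1
        obtain ⟨i, hi⟩ := Function.ne_iff.mp hl
        exact ⟨(l, i), hcp _ _ hi (congrFun h2 i)⟩
      · obtain ⟨i, hi⟩ := hc1 _ _ hk hk1 q hq
        exact ⟨(k, i), hi⟩

/-- Balanced words. -/
abbrev SccT (d k : ℕ) : Type :=
  {x : Fin d × Fin k → Fin d // ∀ a, (Finset.univ.filter (fun i => x i = a)).card = k}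

noncomputable instance (d k : ℕ) : Fintype (SccT d k) := by
  classical
  unfold SccT
  infer_instance

lemma scc_sep {d k : ℕ} (a b : Fin d) (hab : a ≠ b) (x y : SccT d k) (hne : x ≠ y)
    (h : (fun i => if x.1 i = b then a else x.1 i) = (fun i => if y.1 i = b then a else y.1 i)) :
    ∃ i, x.1 i = a ∧ y.1 i = b := by
  classical
  by_contra hcon
  push Not at hcon
  have hi : ∀ i, (if x.1 i = b then a else x.1 i) = (if y.1 i = b then a else y.1 i) :=
    fun i => congrFun h i
  have hsub : Finset.univ.filter (fun i => x.1 i = a) ⊆ Finset.univ.filter (fun i => y.1 i = a) := by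
    intro i
    simp only [Finset.mem_filter, Finset.mem_univ, true_and]
    intro hx
    have h1 := hi i
    have h2 := hcon i hx
    rw [if_neg h2, if_neg (by rw [hx]; exact hab), hx] at h1
    exact h1.symm
  have heq := Finset.eq_of_subset_of_card_le hsub (by rw [x.2, y.2])
  apply hne
  apply Subtype.ext
  funext i
  have h3 := congrArg (fun s => i ∈ s) heq
  simp only [Finset.mem_filter, Finset.mem_univ, true_and, eq_iff_iff] at h3
  have h1 := hi i
  by_cases hx : x.1 i = b <;> by_cases hy : y.1 i = b
  · rw [hx, hy]
  · rw [if_pos hx, if_neg hy] at h1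
    have := h3.mpr h1.symm
    exact absurd (this.symm.trans hx) hab
  · rw [if_neg hx, if_pos hy] at h1
    have := h3.mp h1
    exact absurd (this.symm.trans hy) hab
  · rwa [if_neg hx, if_neg hy] at h1

/-- Every fibre of the merging map is large. -/
lemma scc_fibre {d k : ℕ} (a b : Fin d) (hab : a ≠ b) (x : SccT d k) [DecidableEq (SccT d k)] :
    Nat.centralBinom k ≤ (Finset.univ.filter (fun y : SccT d k =>
      (fun i => if y.1 i = b then a else y.1 i) = (fun i => if x.1 i = b then a else x.1 i))).card := by
  classical
  set U := Finset.univ.filter (fun i => x.1 i = a) ∪ Finset.univ.filter (fun i => x.1 i = b) with hU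
  have hUc : U.card = 2 * k := by
    rw [hU, Finset.card_union_of_disjoint, x.2, x.2, two_mul]
    rw [Finset.disjoint_filter]
    intro i _ h1 h2
    exact hab (h1.symm.trans h2)
  have hUm : ∀ i, i ∈ U ↔ x.1 i = a ∨ x.1 i = b := by intro i; simp [hU]
  let f : Finset (Fin d × Fin k) → (Fin d × Fin k → Fin d) := fun A i =>
    if i ∈ A then a else if i ∈ U then b else x.1 i
  have hf : ∀ A ∈ Finset.powersetCard k U, ∀ c,
      (Finset.univ.filter (fun i => f A i = c)).card = k := by
    intro A hA c
    obtain ⟨hAU, hAc⟩ := Finset.mem_powersetCard.mp hA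
    by_cases hca : c = a
    · subst hca
      refine Eq.trans ?_ hAc
      congr 1
      ext i
      simp only [Finset.mem_filter, Finset.mem_univ, true_and, f]
      have := hUm i
      have := @hAU i
      split_ifs <;> grind
    · by_cases hcb : c = b
      · subst hcb
        have : (U \ A).card = k := by
          rw [Finset.card_sdiff_of_subset hAU, hUc, hAc]; omega
        refine Eq.trans ?_ this
        congr 1
        ext i
        simp only [Finset.mem_filter, Finset.mem_univ, true_and, f, Finset.mem_sdiff]
        have := hUm i
        have := @hAU i
        split_ifs <;> grind
      · refine Eq.trans ?_ (x.2 c)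
        congr 1
        ext i
        simp only [Finset.mem_filter, Finset.mem_univ, true_and, f]
        have := hUm i
        have := @hAU i
        split_ifs <;> grind
  rw [Nat.centralBinom_eq_two_mul_choose, ← hUc, ← Finset.card_powersetCard]
  apply Finset.card_le_card_of_injOn (fun A => if hA : A ∈ Finset.powersetCard k U then
    (⟨f A, hf A hA⟩ : SccT d k) else x)
  · intro A hA
    have hA' : A ∈ Finset.powersetCard k U := hA
    beta_reduce
    rw [dif_pos hA']
    rw [Finset.mem_coe, Finset.mem_filter]
    refine ⟨Finset.mem_univ _, ?_⟩
    obtain ⟨hAU, hAc⟩ := Finset.mem_powersetCard.mp hA'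
    funext i
    simp only [f]
    have := hUm i
    have := @hAU i
    split_ifs <;> grind
  · intro A hA A' hA' heq
    have h1 : A ∈ Finset.powersetCard k U := hA
    have h2 : A' ∈ Finset.powersetCard k U := hA'
    simp only at heq
    rw [dif_pos h1, dif_pos h2] at heq
    have heq' : f A = f A' := congrArg Subtype.val heq
    have hAU := (Finset.mem_powersetCard.mp h1).1
    have hAU' := (Finset.mem_powersetCard.mp h2).1
    ext i
    have h3 := congrFun heq' i
    simp only [f] at h3
    have h4 := @hAU i
    have h5 := @hAU' i
    clear_value U
    clear heq' heq hf hUm hUc hU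
    grind

lemma scc_nonempty (d k : ℕ) : Nonempty (SccT d k) := by
  classical
  refine ⟨⟨fun i => i.1, fun a => ?_⟩⟩
  have : Finset.univ.filter (fun i : Fin d × Fin k => i.1 = a) = {a} ×ˢ Finset.univ := by
    ext ⟨i, j⟩
    simp
    try exact eq_comm
  rw [this, Finset.card_product]; simp

lemma scc_base {d k : ℕ} (a b : Fin d) (hab : a ≠ b) :
    ∃ c : SccT d k → Fin (Fintype.card (SccT d k) / Nat.centralBinom k),
      ∀ x y, x ≠ y → c x = c y → ∃ i, x.1 i = a ∧ y.1 i = b := by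
  classical
  let g : SccT d k → (Fin d × Fin k → Fin d) := fun x i => if x.1 i = b then a else x.1 i
  have hcard : (Finset.univ.image g).card * Nat.centralBinom k ≤ Fintype.card (SccT d k) := by
    rw [← Finset.card_univ, Finset.card_eq_sum_card_image g Finset.univ, ← smul_eq_mul]
    apply Finset.card_nsmul_le_sum
    intro y hy
    obtain ⟨x, -, rfl⟩ := Finset.mem_image.mp hy
    exact scc_fibre a b hab x
  have hle := (Nat.le_div_iff_mul_le (Nat.centralBinom_pos k)).mpr hcard
  have hemb : Nonempty ((Finset.univ.image g) ↪
      Fin (Fintype.card (SccT d k) / Nat.centralBinom k)) := by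
    apply Function.Embedding.nonempty_of_card_le
    rwa [Fintype.card_coe, Fintype.card_fin]
  obtain ⟨em⟩ := hemb
  refine ⟨fun x => em ⟨g x, Finset.mem_image_of_mem _ (Finset.mem_univ _)⟩, ?_⟩
  intro x y hne h
  have h1 := congrArg Subtype.val (em.injective h)
  exact scc_sep a b hab x y hne h1

lemma scc_code (d k N : ℕ) (hd : 2 ≤ d) :
    ∃ (ι : Type) (_ : Fintype ι) (C : Finset (ι → Fin d)),
      Fintype.card ι = N ^ (Finset.univ : Finset (Fin d)).offDiag.card * (d * k) ∧
      (∀ x ∈ C, ∀ y ∈ C, x ≠ y → ∀ a b, a ≠ b → ∃ i, x i = a ∧ y i = b) ∧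
      (Nat.centralBinom k) ^ (N ^ (Finset.univ : Finset (Fin d)).offDiag.card) ≤
        C.card * (d ^ (d * k)) ^ ((N + 1) ^ (Finset.univ : Finset (Fin d)).offDiag.card
          - N ^ (Finset.univ : Finset (Fin d)).offDiag.card) := by
  classical
  set S := (Finset.univ : Finset (Fin d)).offDiag with hS
  set T := SccT d k
  set B := Nat.centralBinom k
  set M := Fintype.card T / B with hMdef
  have hM : 0 < M := by
    obtain ⟨c, -⟩ := scc_base (k := k) (⟨0, by omega⟩ : Fin d) ⟨1, by omega⟩ (by simp)
    obtain ⟨x⟩ := scc_nonempty d k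
    exact (c x).pos
  set L := N ^ S.card
  set e := (N + 1) ^ S.card
  have hcol := scc_colour M N hM
    (fun (p : Fin d × Fin d) (x y : T) => ∃ i, x.1 i = p.1 ∧ y.1 i = p.2) S (by
      intro p hp
      exact scc_base p.1 p.2 (Finset.mem_offDiag.mp hp).2.2)
  change ∃ (ι : Type) (_ : Fintype ι) (c : (ι → T) → ZMod (M ^ e)), Fintype.card ι = L ∧ _ at hcol
  obtain ⟨ι, _, c, hcard, hc⟩ := hcol
  have hLe : L ≤ e := Nat.pow_le_pow_left (Nat.le_succ _) _
  have : NeZero (M ^ e) := ⟨(pow_pos hM _).ne'⟩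
  have hpig : ∃ v, Fintype.card (ι → T) ≤
      (Finset.univ.filter (fun x => c x = v)).card * M ^ e := by
    by_contra hcon
    push Not at hcon
    have h1 : (Finset.univ : Finset (ι → T)).card =
        ∑ v : ZMod (M ^ e), (Finset.univ.filter (fun x => c x = v)).card :=
      Finset.card_eq_sum_card_fiberwise (fun _ _ => Finset.mem_coe.mpr (Finset.mem_univ _))
    have h2 : ∑ v : ZMod (M ^ e), (Finset.univ.filter (fun x => c x = v)).card * M ^ e
        < ∑ v : ZMod (M ^ e), Fintype.card (ι → T) :=
      Finset.sum_lt_sum_of_nonempty ⟨0, Finset.mem_univ _⟩ (fun v _ => hcon v)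
    rw [← Finset.sum_mul, ← h1, Finset.sum_const, Finset.card_univ, Finset.card_univ, ZMod.card,
      smul_eq_mul, mul_comm] at h2
    exact lt_irrefl _ h2
  obtain ⟨v, hv⟩ := hpig
  let F : (ι → T) → (ι × (Fin d × Fin k) → Fin d) := fun x i => (x i.1).1 i.2
  have hF : Function.Injective F := by
    intro x y h
    funext i
    apply Subtype.ext
    funext j
    exact congrFun h (i, j)
  refine ⟨ι × (Fin d × Fin k), inferInstance,
    (Finset.univ.filter (fun x => c x = v)).image F, ?_, ?_, ?_⟩
  · simp [hcard]
  · intro x hx y hy hne a b hab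
    obtain ⟨x, hx1, rfl⟩ := Finset.mem_image.mp hx
    obtain ⟨y, hy1, rfl⟩ := Finset.mem_image.mp hy
    replace hx := (Finset.mem_filter.mp hx1).2
    replace hy := (Finset.mem_filter.mp hy1).2
    obtain ⟨i, j, hj⟩ := hc x y (fun h => hne (by rw [h])) (hx.trans hy.symm) (a, b)
      (by simp [hS, hab])
    exact ⟨(i, j), hj⟩
  · rw [Finset.card_image_of_injective _ hF]
    set q := (Finset.univ.filter (fun x => c x = v)).card
    have hTB : M * B ≤ Fintype.card T := Nat.div_mul_le_self _ _
    have hTd : Fintype.card T ≤ d ^ (d * k) := by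
      have := Fintype.card_le_of_injective (fun x : T => x.1) Subtype.val_injective
      simpa using this
    have hMd : M ≤ d ^ (d * k) := (Nat.div_le_self _ _).trans hTd
    rw [Fintype.card_fun, hcard] at hv
    have h1 : M ^ L * B ^ L ≤ M ^ L * (q * M ^ (e - L)) := by
      calc M ^ L * B ^ L = (M * B) ^ L := (mul_pow _ _ _).symm
        _ ≤ Fintype.card T ^ L := Nat.pow_le_pow_left hTB _
        _ ≤ q * M ^ e := hv
        _ = M ^ L * (q * M ^ (e - L)) := by
          rw [mul_left_comm, ← pow_add, Nat.add_sub_cancel' hLe]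
    exact (Nat.le_of_mul_le_mul_left h1 (pow_pos hM _)).trans
      (Nat.mul_le_mul_left _ (Nat.pow_le_pow_left hMd _))

lemma scc_good (d : ℕ) (hd : 2 ≤ d) (ε : ℝ) (hε : 0 < ε) :
    ∃ (ι : Type) (_ : Fintype ι) (C : Finset (ι → Fin d)), 2 ≤ C.card ∧
      (∀ x ∈ C, ∀ y ∈ C, x ≠ y → ∀ a b, a ≠ b → ∃ i, x i = a ∧ y i = b) ∧
      (Fintype.card ι : ℝ) ≤ (1 / 2 + ε) * d * Real.logb 2 C.card := by
  set s := (Finset.univ : Finset (Fin d)).offDiag.card with hs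
  set η := ε / (1 + 2 * ε) with hη
  have hη0 : 0 < η := by positivity
  have hη1 : η < 1 := by rw [hη, div_lt_one (by positivity)]; linarith
  have hηε : 1 ≤ (1 + 2 * ε) * (1 - η) := by
    have : (1 + 2 * ε) * η = ε := by rw [hη]; field_simp
    nlinarith
  obtain ⟨k, hk4, hk⟩ : ∃ k : ℕ, 4 ≤ k ∧ Real.logb 2 k ≤ η * k := by
    have h1 := Real.isLittleO_log_id_atTop.bound (c := η * Real.log 2)
      (mul_pos hη0 (Real.log_pos (by norm_num)))
    have h2 := tendsto_natCast_atTop_atTop (R := ℝ) |>.eventually h1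
    obtain ⟨k, hk, hk4⟩ := (h2.and (Filter.eventually_ge_atTop 4)).exists
    refine ⟨k, hk4, ?_⟩
    rw [Real.logb, div_le_iff₀ (Real.log_pos (by norm_num))]
    simp only [id, Real.norm_eq_abs, Nat.abs_cast] at hk
    calc Real.log k ≤ |Real.log k| := le_abs_self _
      _ ≤ _ := hk
      _ = _ := by ring
  have hD : 0 ≤ (d : ℝ) * Real.logb 2 d := by
    apply mul_nonneg (by positivity)
    apply Real.logb_nonneg (by norm_num)
    exact_mod_cast (by omega : 1 ≤ d)
  obtain ⟨N, hN1, hN⟩ : ∃ N : ℕ, 1 ≤ N ∧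
      ((1 + 1 / (N : ℝ)) ^ s - 1) * (d * Real.logb 2 d) < η := by
    have h1 : Filter.Tendsto (fun N : ℕ => ((1 + 1 / (N : ℝ)) ^ s - 1) * (d * Real.logb 2 d))
        Filter.atTop (nhds (((1 + 0) ^ s - 1) * (d * Real.logb 2 d))) :=
      (((tendsto_const_nhds.add tendsto_one_div_atTop_nhds_zero_nat).pow s).sub_const 1).mul_const _
    have h2 := h1.eventually_lt_const (u := η) (by simpa using hη0)
    obtain ⟨N, hN, hN1⟩ := (h2.and (Filter.eventually_ge_atTop 1)).exists
    exact ⟨N, hN1, hN⟩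
  obtain ⟨ι, _, C, hcard, hsep, hbig⟩ := scc_code d k N hd
  rw [← hs] at hcard hbig
  have hk0 : (0 : ℝ) < k := by exact_mod_cast (by omega : 0 < k)
  have hd0 : (0 : ℝ) < d := by exact_mod_cast (by omega : 0 < d)
  have hN0 : (0 : ℝ) < N := by exact_mod_cast hN1
  set q := C.card
  have hq0 : 0 < q := by
    rcases Nat.eq_zero_or_pos q with h | h
    · rw [h, zero_mul] at hbig
      exact absurd hbig (not_le.mpr (pow_pos (Nat.centralBinom_pos k) _))
    · exact h
  have hq0' : (0 : ℝ) < q := by exact_mod_cast hq0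
  have hB0 : (0 : ℝ) < Nat.centralBinom k := by exact_mod_cast Nat.centralBinom_pos k
  have hB : 2 * (k : ℝ) - Real.logb 2 k ≤ Real.logb 2 (Nat.centralBinom k) := by
    have h1 : (4 : ℝ) ^ k ≤ k * Nat.centralBinom k := by
      exact_mod_cast (Nat.four_pow_lt_mul_centralBinom k hk4).le
    have h2 := Real.logb_le_logb_of_le (b := 2) (by norm_num) (by positivity) h1
    rw [Real.logb_mul hk0.ne' hB0.ne', Real.logb_pow] at h2
    have h4 : Real.logb 2 4 = 2 := by
      rw [show (4 : ℝ) = 2 ^ (2 : ℕ) by norm_num, Real.logb_pow, Real.logb_self_eq_one (by norm_num)]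
      norm_num
    rw [h4] at h2
    linarith
  have hlog : (N : ℝ) ^ s * Real.logb 2 (Nat.centralBinom k) ≤
      Real.logb 2 q + (((N : ℝ) + 1) ^ s - (N : ℝ) ^ s) * (d * k * Real.logb 2 d) := by
    have h1 : ((Nat.centralBinom k : ℝ)) ^ (N ^ s) ≤
        q * ((d : ℝ) ^ (d * k)) ^ ((N + 1) ^ s - N ^ s) := by exact_mod_cast hbig
    have h2 := Real.logb_le_logb_of_le (b := 2) (by norm_num) (by positivity) h1
    rw [Real.logb_mul hq0'.ne' (by positivity), Real.logb_pow, Real.logb_pow, Real.logb_pow,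
      Nat.cast_sub (Nat.pow_le_pow_left (Nat.le_succ _) _)] at h2
    push_cast at h2
    linarith
  set L : ℝ := (N : ℝ) ^ s with hL
  have hL1 : 1 ≤ L := one_le_pow₀ (by exact_mod_cast hN1)
  have hE : ((N : ℝ) + 1) ^ s = L * (1 + 1 / (N : ℝ)) ^ s := by
    rw [hL, ← mul_pow]
    congr 1
    field_simp
  have hmain : L * k * (2 * (1 - η)) ≤ Real.logb 2 q := by
    have h1 : L * (2 * (k : ℝ) - η * k) ≤ L * Real.logb 2 (Nat.centralBinom k) :=
      mul_le_mul_of_nonneg_left (by linarith) (by linarith)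
    have h2 : (((N : ℝ) + 1) ^ s - L) * (d * k * Real.logb 2 d) ≤ (L * k) * η := by
      rw [hE]
      calc (L * (1 + 1 / (N : ℝ)) ^ s - L) * (d * k * Real.logb 2 d)
          = (L * k) * (((1 + 1 / (N : ℝ)) ^ s - 1) * (d * Real.logb 2 d)) := by ring
        _ ≤ _ := mul_le_mul_of_nonneg_left hN.le (by positivity)
    nlinarith
  refine ⟨ι, inferInstance, C, ?_, hsep, ?_⟩
  · by_contra hlt
    have : q = 1 := by omega
    rw [this] at hmain
    simp only [Nat.cast_one, Real.logb_one] at hmain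
    have : 0 < L * k * (2 * (1 - η)) := by
      have : 0 < 1 - η := by linarith
      positivity
    linarith
  · rw [hcard]
    push_cast
    rw [← hL]
    calc L * (d * k) = (d * (L * k)) * 1 := by ring
      _ ≤ (d * (L * k)) * ((1 + 2 * ε) * (1 - η)) :=
        mul_le_mul_of_nonneg_left hηε (by positivity)
      _ = (1 / 2 + ε) * d * (L * k * (2 * (1 - η))) := by ring
      _ ≤ _ := mul_le_mul_of_nonneg_left hmain (by positivity)

lemma scc_cover (t d : ℕ) {I : Type} [Fintype I] (x : Fin t → I → Fin d)
    (hx : ∀ i j, i ≠ j → ∀ a b, a ≠ b → ∃ l, x i l = a ∧ x j l = b) :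
    sigmaCliqueCover (Ktd t d) ≤ (Fintype.card I + d) * t := by
  classical
  let g : (I ⊕ Fin d) → Fin t → Fin d := fun l i => Sum.elim (fun l => x i l) (fun a => a) l
  let em : (I ⊕ Fin d) → (Fin t ↪ (Σ _ : Fin t, Fin d)) := fun l =>
    ⟨fun i => ⟨i, g l i⟩, fun i j h => congrArg Sigma.fst h⟩
  apply Nat.sInf_le
  refine ⟨(Finset.univ : Finset (I ⊕ Fin d)).val.map (fun l => Finset.univ.map (em l)), ?_, ?_, ?_⟩
  · intro c hc
    obtain ⟨l, -, rfl⟩ := Multiset.mem_map.mp hc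
    intro u hu v hv huv
    simp only [Finset.coe_map, Finset.coe_univ, Set.image_univ, Set.mem_range] at hu hv
    obtain ⟨i, rfl⟩ := hu
    obtain ⟨j, rfl⟩ := hv
    show i ≠ j
    rintro rfl
    exact huv rfl
  · rintro ⟨i, a⟩ ⟨j, b⟩ hij
    have hij : i ≠ j := hij
    by_cases hab : a = b
    · subst hab
      refine ⟨_, Multiset.mem_map.mpr ⟨Sum.inr a, Finset.mem_univ _, rfl⟩, ?_, ?_⟩
      · exact Finset.mem_map.mpr ⟨i, Finset.mem_univ _, rfl⟩
      · exact Finset.mem_map.mpr ⟨j, Finset.mem_univ _, rfl⟩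
    · obtain ⟨l, h1, h2⟩ := hx i j hij a b hab
      refine ⟨_, Multiset.mem_map.mpr ⟨Sum.inl l, Finset.mem_univ _, rfl⟩, ?_, ?_⟩
      · exact Finset.mem_map.mpr ⟨i, Finset.mem_univ _, by rw [← h1]; rfl⟩
      · exact Finset.mem_map.mpr ⟨j, Finset.mem_univ _, by rw [← h2]; rfl⟩
  · rw [Multiset.map_map]
    simp

/-- **Theorem (upper bound).** For every `d ≥ 2` and `ε > 0` there is `t₀` such
that for every `t ≥ t₀`, `scc(K_t(d)) ≤ (1/2 + ε) · d · t · log₂ t`. -/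
theorem stmt4 (d : ℕ) (hd : 2 ≤ d) (ε : ℝ) (hε : 0 < ε) :
    ∃ t0 : ℕ, ∀ t : ℕ, t0 ≤ t →
      (sigmaCliqueCover (Ktd t d) : ℝ) ≤ (1 / 2 + ε) * d * t * Real.logb 2 t := by
  classical
  obtain ⟨ι, _, C, hC2, hsep, hrate⟩ := scc_good d hd (ε / 2) (by positivity)
  have hd0 : (0 : ℝ) < d := by exact_mod_cast (by omega : 0 < d)
  have hlim : Filter.Tendsto (fun t : ℕ => ε / 2 * d * Real.logb 2 (t : ℝ))
      Filter.atTop Filter.atTop :=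
    ((Real.tendsto_logb_atTop (by norm_num)).comp tendsto_natCast_atTop_atTop).const_mul_atTop
      (by positivity)
  obtain ⟨t1, ht1⟩ := Filter.eventually_atTop.mp
    (hlim.eventually_ge_atTop ((Fintype.card ι : ℝ) + d))
  refine ⟨max t1 2, fun t ht => ?_⟩
  have ht2 : 2 ≤ t := (le_max_right _ _).trans ht
  have hlow := ht1 t ((le_max_left _ _).trans ht)
  set q := C.card
  set m := Nat.clog q t with hm
  have htm : t ≤ q ^ m := Nat.le_pow_clog (by omega) t
  have htm' : q ^ (m - 1) < t := Nat.pow_pred_clog_lt_self (by omega) (by omega)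
  have hq1 : (1 : ℝ) < q := by exact_mod_cast (by omega : 1 < q)
  have hlq : 0 < Real.logb 2 q := Real.logb_pos (by norm_num) hq1
  have ht0 : (0 : ℝ) < t := by exact_mod_cast (by omega : 0 < t)
  have hmlog : ((m : ℝ) - 1) * Real.logb 2 q ≤ Real.logb 2 t := by
    have h1 : (q : ℝ) ^ (m - 1) ≤ t := by exact_mod_cast htm'.le
    have h2 := Real.logb_le_logb_of_le (b := 2) (by norm_num) (by positivity) h1
    rw [Real.logb_pow] at h2
    have h3 : (m : ℝ) - 1 ≤ ((m - 1 : ℕ) : ℝ) := by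
      have : m ≤ (m - 1) + 1 := by omega
      have : (m : ℝ) ≤ ((m - 1 : ℕ) : ℝ) + 1 := by exact_mod_cast this
      linarith
    exact (mul_le_mul_of_nonneg_right h3 hlq.le).trans h2
  have hemb : Nonempty (Fin t ↪ (Fin m → C)) := by
    apply Function.Embedding.nonempty_of_card_le
    rw [Fintype.card_fun, Fintype.card_fin, Fintype.card_fin, Fintype.card_coe]
    exact htm
  obtain ⟨em⟩ := hemb
  have hcov := scc_cover t d (I := Fin m × ι) (fun i l => (em i l.1).1 l.2) (by
    intro i j hij a b hab
    obtain ⟨r, hr⟩ := Function.ne_iff.mp (em.injective.ne hij)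
    obtain ⟨l, hl⟩ := hsep _ (em i r).2 _ (em j r).2 (fun h => hr (Subtype.ext h)) a b hab
    exact ⟨(r, l), hl⟩)
  rw [Fintype.card_prod, Fintype.card_fin] at hcov
  have hcov' : (sigmaCliqueCover (Ktd t d) : ℝ) ≤ ((m : ℝ) * Fintype.card ι + d) * t := by
    exact_mod_cast hcov
  refine hcov'.trans ?_
  have hkey : (m : ℝ) * Fintype.card ι + d ≤ (1 / 2 + ε) * d * Real.logb 2 t := by
    have hlt : 0 ≤ Real.logb 2 (t : ℝ) :=
      Real.logb_nonneg (by norm_num) (by exact_mod_cast (by omega : 1 ≤ t))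
    have h1 : ((m : ℝ) - 1) * Fintype.card ι ≤ (1 / 2 + ε / 2) * d * Real.logb 2 t := by
      have hm1 : (0 : ℝ) ≤ (m : ℝ) - 1 := by
        have : 0 < m := Nat.clog_pos (by omega) ht2
        have : (1 : ℝ) ≤ m := by exact_mod_cast this
        linarith
      calc ((m : ℝ) - 1) * Fintype.card ι
          ≤ ((m : ℝ) - 1) * ((1 / 2 + ε / 2) * d * Real.logb 2 q) :=
            mul_le_mul_of_nonneg_left hrate hm1
        _ = (1 / 2 + ε / 2) * d * (((m : ℝ) - 1) * Real.logb 2 q) := by ring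
        _ ≤ _ := mul_le_mul_of_nonneg_left hmlog (by positivity)
    linarith
  calc ((m : ℝ) * Fintype.card ι + d) * t ≤ ((1 / 2 + ε) * d * Real.logb 2 t) * t :=
        mul_le_mul_of_nonneg_right hkey ht0.le
    _ = _ := by ring
end

section
/- For every integer $d \ge 2$ we have $\lim_{n \to \infty} \frac{1}{n} \log_2 N(n, d) = \frac{2}{d}$, where $N(n,d)$ is the largest cardinality of a family of $d$-partitions of an $n$-element set in which any two distinct partitions are qualitatively independent. -/
/-- `qiPartFamilies n d t` says that there is a family of `t` ordered
`d`-partitions of an `n`-element set (modelled as `Fin n`) that are pairwise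
qualitatively independent: any class of one partition meets any class of any
other partition of the family. -/
def qiPartFamilies (n d t : ℕ) : Prop :=
  ∃ A : Fin t → Fin d → Set (Fin n),
    (∀ (i : Fin t) (j j' : Fin d), j ≠ j' → A i j ∩ A i j' = ∅) ∧
    (∀ i : Fin t, (⋃ j : Fin d, A i j) = Set.univ) ∧
    (∀ i i' : Fin t, i ≠ i' → ∀ j j' : Fin d, (A i j ∩ A i' j').Nonempty)

/-- `N n d` is the largest cardinality of a family of pairwise qualitatively
independent `d`-partitions of an `n`-element set. -/
noncomputable def qiNumber (n d : ℕ) : ℕ :=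
  sSup {t : ℕ | qiPartFamilies n d t}


theorem gkv_combine {U G : Type} [AddGroup G] (g1 g2 : U → G) (q : ℕ)
    (z z' : Fin (q + 1) → U) (hne : z ≠ z') (h0 : z 0 = z' 0)
    (hl : z (Fin.last q) = z' (Fin.last q))
    (hd : ∀ i : Fin q, g1 (z i.succ) - g2 (z i.castSucc) = g1 (z' i.succ) - g2 (z' i.castSucc)) :
    (∃ i, z i ≠ z' i ∧ g1 (z i) = g1 (z' i)) ∧ (∃ i, z i ≠ z' i ∧ g2 (z i) = g2 (z' i)) := by
  constructor
  · by_contra hcon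
    push Not at hcon
    apply hne
    funext i
    induction i using Fin.induction with
    | zero => exact h0
    | succ i ih =>
      by_contra h
      have := hd i
      rw [ih] at this
      exact hcon _ h (sub_left_injective this)
  · by_contra hcon
    push Not at hcon
    apply hne
    funext i
    induction i using Fin.reverseInduction with
    | last => exact hl
    | cast i ih =>
      by_contra h
      have := hd i
      rw [ih] at this
      exact hcon _ h (sub_right_injective this)

theorem gkv_color {T E : Type} [Fintype T] [Nonempty T] [DecidableEq E] (C : E → Type) [∀ e, Fintype (C e)]
    (f : ∀ e, T → C e) (r : ℝ) (hr1 : 1 ≤ r) (hr : ∀ e, (Fintype.card (C e) : ℝ) ≤ r)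
    (S : Finset E) : ∀ c : ℝ, r < c → ∃ m : ℕ, 1 ≤ m ∧ ∃ (D : Type) (_ : Fintype D)
      (g : (Fin m → T) → D), (Fintype.card D : ℝ) ≤ c ^ m ∧
      ∀ z z', z ≠ z' → g z = g z' → ∀ e ∈ S, ∃ i, z i ≠ z' i ∧ f e (z i) = f e (z' i) := by
  classical
  induction S using Finset.induction_on with
  | empty =>
    intro c hc
    refine ⟨1, le_rfl, Unit, inferInstance, fun _ => (), ?_, by simp⟩
    simp; linarith
  | insert e S he ih =>
    intro c hc
    obtain ⟨c', hc1, hc2⟩ := exists_between hc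
    obtain ⟨m, hm, D, _, g, hD, hg⟩ := ih c' hc1
    have hc'0 : 0 < c' := by linarith
    have hc'1 : 1 ≤ c' := by linarith
    set R : ℕ := max 1 (max (Fintype.card D) (Fintype.card (Fin m → C e))) with hR
    have hRc : (R : ℝ) ≤ c' ^ m := by
      rw [hR]; push_cast
      refine max_le (one_le_pow₀ hc'1) (max_le hD ?_)
      rw [Fintype.card_fun, Fintype.card_fin]
      push_cast
      exact pow_le_pow_left₀ (by positivity) ((hr e).trans hc1.le) _
    have : NeZero R := ⟨Nat.one_le_iff_ne_zero.1 (le_max_left _ _)⟩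
    obtain ⟨u1⟩ : Nonempty (D ↪ ZMod R) := Function.Embedding.nonempty_of_card_le (by
      rw [ZMod.card]; exact (le_max_left _ _).trans (le_max_right _ _))
    obtain ⟨u2⟩ : Nonempty ((Fin m → C e) ↪ ZMod R) := Function.Embedding.nonempty_of_card_le (by
      rw [ZMod.card]; exact (le_max_right _ _).trans (le_max_right _ _))
    let g1 : (Fin m → T) → ZMod R := fun z => u1 (g z)
    let g2 : (Fin m → T) → ZMod R := fun z => u2 (fun i => f e (z i))
    set N : ℝ := (Fintype.card (Fin m → T) : ℝ) with hN
    -- choose the number of blocks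
    obtain ⟨q, hq⟩ : ∃ q : ℕ, N * N < (c / c') ^ q :=
      pow_unbounded_of_one_lt _ (by rw [one_lt_div hc'0]; exact hc2)
    have hq' : N * N * c' ^ q ≤ c ^ q := by
      rw [div_pow, lt_div_iff₀ (by positivity)] at hq
      exact hq.le
    have hcc : 1 ≤ c / c' := by rw [one_le_div hc'0]; exact hc2.le
    let φ : (Fin ((q + 1) * m) → T) → Fin (q + 1) → Fin m → T :=
      fun z i j => z (finProdFinEquiv (i, j))
    have hφ : Function.Injective φ := by
      intro z z' h
      funext k
      have := congrFun (congrFun h (finProdFinEquiv.symm k).1) (finProdFinEquiv.symm k).2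
      simpa only [φ, Prod.mk.eta, Equiv.apply_symm_apply] using this
    refine ⟨(q + 1) * m, Nat.mul_pos (Nat.succ_pos _) hm,
      (Fin m → T) × (Fin m → T) × (Fin q → ZMod R), inferInstance,
      fun z => (φ z 0, φ z (Fin.last q), fun i => g1 (φ z i.succ) - g2 (φ z i.castSucc)), ?_, ?_⟩
    · rw [Fintype.card_prod, Fintype.card_prod, Fintype.card_fun (α := Fin q), ZMod.card, Fintype.card_fin]
      push_cast only [Nat.cast_mul, Nat.cast_pow]
      rw [← hN, ← mul_assoc]
      calc N * N * (R : ℝ) ^ q ≤ N * N * (c' ^ m) ^ q := by gcongr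
        _ ≤ (c / c') ^ q * (c' ^ m) ^ q := by gcongr
        _ ≤ ((c / c') ^ m) ^ q * (c' ^ m) ^ q := by
            gcongr
            exact le_self_pow₀ hcc (by omega)
        _ = (c ^ m) ^ q := by
            rw [← mul_pow, ← mul_pow, div_mul_cancel₀ _ hc'0.ne']
        _ ≤ c ^ ((q + 1) * m) := by
            rw [← pow_mul]
            exact pow_le_pow_right₀ (by linarith) (by nlinarith)
    · intro z z' hne h e' he'
      simp only [Prod.mk.injEq] at h
      obtain ⟨h0, hl, hd⟩ := h
      obtain ⟨⟨i, hi, hi'⟩, ⟨j, hj, hj'⟩⟩ := gkv_combine g1 g2 q (φ z) (φ z') (fun h => hne (hφ h)) h0 hl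
        (fun i => congrFun hd i)
      rcases Finset.mem_insert.1 he' with rfl | he'
      · have h2 := u2.injective hj'
        obtain ⟨l, hl⟩ := Function.ne_iff.1 hj
        exact ⟨finProdFinEquiv (j, l), hl, congrFun h2 l⟩
      · obtain ⟨l, hl, hl'⟩ := hg _ _ hi (u1.injective hi') e' he'
        exact ⟨finProdFinEquiv (i, l), hl, hl'⟩

/-- balanced words -/
abbrev gkvT (d k : ℕ) : Type :=
  {x : Fin d × Fin k → Fin d // ∀ a, (Finset.univ.filter (fun i => x i = a)).card = k}

/-- merging the letter `b` into `a` -/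
def gkvMerge {d k : ℕ} (e : Fin d × Fin d) (x : gkvT d k) : Fin d × Fin k → Fin d :=
  fun i => if x.1 i = e.2 then e.1 else x.1 i

theorem gkvT_nonempty (d k : ℕ) : Nonempty (gkvT d k) := by
  refine ⟨⟨fun i => i.1, fun a => ?_⟩⟩
  have : (Finset.univ.filter (fun i : Fin d × Fin k => i.1 = a)) = {a} ×ˢ Finset.univ := by
    ext ⟨i, j⟩; simp [eq_comm]
  rw [this]; simp

theorem gkv_merge_good {d k : ℕ} (e : Fin d × Fin d) (x y : gkvT d k)
    (hne : x ≠ y) (h : gkvMerge e x = gkvMerge e y) : ∃ i, x.1 i = e.1 ∧ y.1 i = e.2 := by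
  by_contra hcon
  push Not at hcon
  obtain ⟨a, b⟩ := e
  have h' : ∀ i, (if x.1 i = b then a else x.1 i) = (if y.1 i = b then a else y.1 i) :=
    fun i => congrFun h i
  simp only at hcon
  have hsub : Finset.univ.filter (fun i => x.1 i = a) ⊆ Finset.univ.filter (fun i => y.1 i = a) := by
    intro i hi
    simp only [Finset.mem_filter, Finset.mem_univ, true_and] at hi ⊢
    have := h' i
    have := hcon i hi
    grind
  have heq := Finset.eq_of_subset_of_card_le hsub (by rw [x.2, y.2])
  apply hne
  apply Subtype.ext
  funext i
  have h1 : x.1 i = a ↔ y.1 i = a := by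
    have := Finset.ext_iff.1 heq i
    simpa using this
  have := h' i
  grind

theorem gkv_fibre {d k : ℕ} (e : Fin d × Fin d) (hab : e.1 ≠ e.2) (x : gkvT d k) :
    Nat.centralBinom k ≤
      (Finset.univ.filter (fun y : gkvT d k => gkvMerge e y = gkvMerge e x)).card := by
  obtain ⟨a, b⟩ := e
  simp only at hab
  set X := Finset.univ.filter (fun i => x.1 i = a ∨ x.1 i = b) with hX
  have hXc : X.card = 2 * k := by
    rw [hX, Finset.filter_or, Finset.card_union_of_disjoint, x.2, x.2, two_mul]
    rw [Finset.disjoint_filter]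
    grind
  let w : Finset (Fin d × Fin k) → Fin d × Fin k → Fin d :=
    fun s i => if i ∈ X then (if i ∈ s then a else b) else x.1 i
  have hw : ∀ s ∈ X.powersetCard k, ∀ c, (Finset.univ.filter (fun i => w s i = c)).card = k := by
    intro s hs c
    rw [Finset.mem_powersetCard] at hs
    by_cases hca : c = a
    · subst hca
      refine Eq.trans ?_ hs.2
      congr 1
      ext i
      have := @hs.1 i
      simp only [Finset.mem_filter, Finset.mem_univ, true_and, w, hX] at this ⊢
      grind
    by_cases hcb : c = b
    · subst hcb
      have : Finset.univ.filter (fun i => w s i = c) = X \ s := by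
        ext i
        have := @hs.1 i
        simp only [Finset.mem_filter, Finset.mem_univ, true_and, w, hX, Finset.mem_sdiff] at this ⊢
        grind
      rw [this, Finset.card_sdiff_of_subset hs.1, hXc, hs.2]
      omega
    · refine Eq.trans ?_ (x.2 c)
      congr 1
      ext i
      simp only [Finset.mem_filter, Finset.mem_univ, true_and, w, hX]
      grind
  rw [Nat.centralBinom, ← hXc, ← Finset.card_powersetCard, ← Finset.card_attach]
  refine Finset.card_le_card_of_injOn (fun s => ⟨w s.1, hw s.1 s.2⟩) ?_ ?_
  · intro s _
    simp only [Finset.coe_filter, Finset.mem_univ, true_and, Set.mem_ofPred_eq]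
    funext i
    simp only [gkvMerge, w, hX, Finset.mem_filter, Finset.mem_univ, true_and]
    grind
  · intro s _ s' _ hss
    have h1 : w s.1 = w s'.1 := congrArg Subtype.val hss
    apply Subtype.ext
    ext i
    have h2 := congrFun h1 i
    have hs := @(Finset.mem_powersetCard.1 s.2).1 i
    have hs' := @(Finset.mem_powersetCard.1 s'.2).1 i
    simp only [w] at h2
    grind

theorem gkv_range_card {d k : ℕ} (e : Fin d × Fin d) (hab : e.1 ≠ e.2) :
    (Finset.univ.image (gkvMerge (k := k) e)).card * Nat.centralBinom k ≤
      Fintype.card (gkvT d k) := by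
  rw [← Finset.card_univ, Finset.card_eq_sum_card_image (gkvMerge (k := k) e) Finset.univ,
    ← smul_eq_mul]
  apply Finset.card_nsmul_le_sum
  intro c hc
  obtain ⟨x, -, rfl⟩ := Finset.mem_image.1 hc
  exact gkv_fibre e hab x

theorem gkv_upper (n d t : ℕ) (hd : 2 ≤ d) (h : qiPartFamilies n d t) :
    (t : ℝ) ≤ (2 : ℝ) ^ (2 * (n : ℝ) / d) := by
  classical
  obtain ⟨A, hdis, hcov, hint⟩ := h
  have : NeZero d := ⟨by omega⟩
  let B : Fin t → Fin d → Finset (Fin n) := fun i j => (A i j).toFinset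
  have hB : ∀ i j x, x ∈ B i j ↔ x ∈ A i j := by intro i j x; simp [B]
  have hBdis : ∀ i j j', j ≠ j' → Disjoint (B i j) (B i j') := by
    intro i j j' hj
    rw [Finset.disjoint_left]
    intro x hx hx'
    rw [hB] at hx hx'
    have : x ∈ A i j ∩ A i j' := ⟨hx, hx'⟩
    rw [hdis i j j' hj] at this
    exact this
  have hsum : ∀ i, ∑ j, (B i j).card = n := by
    intro i
    rw [← Finset.card_biUnion (fun j _ j' _ hj => hBdis i j j' hj)]
    have : Finset.univ.biUnion (B i) = Finset.univ := by
      ext x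
      have : x ∈ ⋃ j, A i j := by rw [hcov i]; trivial
      simpa [hB] using this
    rw [this]; simp
  have h1 : (1 : Fin d) ≠ 0 := by
    intro h
    have := congrArg Fin.val h
    rw [Fin.val_one', Fin.val_zero, Nat.mod_eq_of_lt (by omega)] at this
    omega
  have hpick : ∀ i, ∃ j, d * ((B i j).card + (B i (j + 1)).card) ≤ 2 * n := by
    intro i
    by_contra hcon
    push Not at hcon
    have hs : ∑ j, ((B i j).card + (B i (j + 1)).card) = 2 * n := by
      have h2 := Equiv.sum_comp (Equiv.addRight (1 : Fin d)) (fun j => (B i j).card)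
      simp only [Equiv.coe_addRight] at h2
      rw [Finset.sum_add_distrib, hsum, h2, hsum, two_mul]
    have : ∑ j : Fin d, 2 * n < ∑ j, d * ((B i j).card + (B i (j + 1)).card) :=
      Finset.sum_lt_sum_of_nonempty ⟨0, Finset.mem_univ _⟩ (fun j _ => hcon j)
    rw [← Finset.mul_sum (Finset.univ) (fun j => (B i j).card + (B i (j + 1)).card), hs] at this
    simp at this
  choose p hp using hpick
  have hpd : ∀ i, Disjoint (B i (p i)) (B i (p i + 1)) := fun i => hBdis i _ _ (by
    intro h; exact h1 (by simpa using h.symm))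
  let I : Fin t → Finset (Finset (Fin n)) := fun i => Finset.Icc (B i (p i)) (B i (p i + 1))ᶜ
  have hIdis : ∀ i i', i ≠ i' → Disjoint (I i) (I i') := by
    intro i i' hi
    rw [Finset.disjoint_left]
    intro s hs hs'
    obtain ⟨x, hx, hx'⟩ := hint i i' hi (p i) (p i' + 1)
    have h1 := (Finset.mem_Icc.1 hs).1 ((hB _ _ _).2 hx)
    have h2 := (Finset.mem_Icc.1 hs').2 h1
    exact Finset.mem_compl.1 h2 ((hB _ _ _).2 hx')
  have hcard : ∑ i, (I i).card ≤ 2 ^ n := by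
    rw [← Finset.card_biUnion (fun i _ j _ hj => hIdis i j hj)]
    refine (Finset.card_le_univ _).trans ?_
    simp
  have hlow : ∀ i, (2 : ℝ) ^ ((n : ℝ) - 2 * n / d) ≤ ((I i).card : ℝ) := by
    intro i
    have hle : B i (p i) ⊆ (B i (p i + 1))ᶜ := by
      intro x hx
      exact Finset.mem_compl.2 (Finset.disjoint_left.1 (hpd i) hx)
    have hc : (B i (p i)).card ≤ (B i (p i + 1))ᶜ.card := Finset.card_le_card hle
    have hc2 : (B i (p i + 1)).card ≤ n := by
      simpa using Finset.card_le_univ (B i (p i + 1))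
    have e1 : (I i).card = 2 ^ ((B i (p i + 1))ᶜ.card - (B i (p i)).card) :=
      Finset.card_Icc_finset hle
    rw [e1]
    push_cast
    rw [← Real.rpow_natCast]
    apply Real.rpow_le_rpow_of_exponent_le (by norm_num)
    rw [Nat.cast_sub hc, Finset.card_compl, Fintype.card_fin, Nat.cast_sub hc2]
    have h3 : (d : ℝ) * ((B i (p i)).card + (B i (p i + 1)).card) ≤ 2 * n := by
      exact_mod_cast hp i
    have hd0 : (0 : ℝ) < d := by positivity
    have : ((B i (p i)).card : ℝ) + (B i (p i + 1)).card ≤ 2 * n / d := by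
      rw [le_div_iff₀ hd0]; linarith
    linarith
  have hfin : (t : ℝ) * (2 : ℝ) ^ ((n : ℝ) - 2 * n / d) ≤ 2 ^ (n : ℝ) := by
    calc (t : ℝ) * (2 : ℝ) ^ ((n : ℝ) - 2 * n / d) = ∑ i : Fin t, (2 : ℝ) ^ ((n : ℝ) - 2 * n / d) := by simp
      _ ≤ ∑ i : Fin t, ((I i).card : ℝ) := Finset.sum_le_sum (fun i _ => hlow i)
      _ ≤ 2 ^ (n : ℝ) := by rw [Real.rpow_natCast]; exact_mod_cast hcard
  rw [Real.rpow_sub (by norm_num), ← mul_div_assoc, div_le_iff₀ (by positivity), mul_comm] at hfin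
  exact le_of_mul_le_mul_left hfin (by positivity)

theorem gkv_bdd (n d : ℕ) (hd : 2 ≤ d) : BddAbove {t : ℕ | qiPartFamilies n d t} :=
  ⟨⌊(2 : ℝ) ^ (2 * (n : ℝ) / d)⌋₊, fun t ht => Nat.le_floor (gkv_upper n d t hd ht)⟩

theorem gkv_mem (n d : ℕ) (hd : 2 ≤ d) : qiPartFamilies n d (qiNumber n d) :=
  Nat.sSup_mem (s := {t : ℕ | qiPartFamilies n d t}) ⟨0, ⟨fun i => i.elim0, fun i => i.elim0, fun i => i.elim0, fun i => i.elim0⟩⟩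
    (gkv_bdd n d hd)

theorem gkv_words (n d : ℕ) {ι α : Type} [Fintype ι] [Fintype α] [NeZero d] (W : α → ι → Fin d)
    (hW : ∀ u v, u ≠ v → ∀ a b, a ≠ b → ∃ i, W u i = a ∧ W v i = b) (q : ℕ)
    (hq : q * Fintype.card ι + d ≤ n) : qiPartFamilies n d (Fintype.card α ^ q) := by
  classical
  obtain ⟨s⟩ : Nonempty (((Fin q × ι) ⊕ Fin d) ↪ Fin n) :=
    Function.Embedding.nonempty_of_card_le (by simpa using hq)
  have hc : Fintype.card (Fin (Fintype.card α ^ q)) = Fintype.card (Fin q → α) := by simp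
  let ψ := Fintype.equivOfCardEq hc
  let F : (Fin q → α) → Fin n → Fin d := fun u =>
    Function.extend s (Sum.elim (fun ji => W (u ji.1) ji.2) id) (fun _ => 0)
  have hF : ∀ u v, u ≠ v → ∀ a b, ∃ k, F u k = a ∧ F v k = b := by
    intro u v huv a b
    by_cases hab : a = b
    · subst hab
      refine ⟨s (Sum.inr a), ?_, ?_⟩ <;> simp [F, s.injective.extend_apply]
    · obtain ⟨j, hj⟩ := Function.ne_iff.1 huv
      obtain ⟨i, hi, hi'⟩ := hW _ _ hj a b hab
      refine ⟨s (Sum.inl (j, i)), ?_, ?_⟩ <;> simpa [F, s.injective.extend_apply]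
  refine ⟨fun i j => {k | F (ψ i) k = j}, ?_, ?_, ?_⟩
  · intro i j j' hj
    ext k
    simp only [Set.mem_inter_iff, Set.mem_ofPred_eq, Set.mem_empty_iff_false, iff_false]
    rintro ⟨rfl, h⟩
    exact hj h
  · intro i
    ext k
    simp
  · intro i i' hi j j'
    obtain ⟨k, h1, h2⟩ := hF (ψ i) (ψ i') (fun h => hi (ψ.injective h)) j j'
    exact ⟨k, h1, h2⟩

theorem gkv_exists (d k : ℕ) (hd : 2 ≤ d) : ∃ m : ℕ, 1 ≤ m ∧ ∃ (α : Type) (_ : Fintype α)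
    (W : α → (Fin m × (Fin d × Fin k)) → Fin d),
    (∀ u v, u ≠ v → ∀ a b, a ≠ b → ∃ i, W u i = a ∧ W v i = b) ∧
    ((Nat.centralBinom k : ℝ) / 2) ^ m ≤ Fintype.card α := by
  classical
  have := gkvT_nonempty d k
  let E : Type := {e : Fin d × Fin d // e.1 ≠ e.2}
  let C : E → Type := fun e => {c // c ∈ Finset.univ.image (gkvMerge (k := k) e.1)}
  let f : ∀ e : E, gkvT d k → C e :=
    fun e x => ⟨gkvMerge e.1 x, Finset.mem_image_of_mem _ (Finset.mem_univ _)⟩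
  have hM : 0 < (Nat.centralBinom k : ℝ) := by exact_mod_cast Nat.centralBinom_pos k
  set r : ℝ := (Fintype.card (gkvT d k) : ℝ) / Nat.centralBinom k with hrdef
  have hr : ∀ e, (Fintype.card (C e) : ℝ) ≤ r := by
    intro e
    rw [hrdef, le_div_iff₀ hM]
    have := gkv_range_card (k := k) e.1 e.2
    simp only [C, Fintype.card_coe]
    exact_mod_cast this
  have hr1 : 1 ≤ r := by
    let e0 : E := ⟨(⟨0, by omega⟩, ⟨1, by omega⟩), by simp⟩
    refine le_trans ?_ (hr e0)
    have : Nonempty (C e0) := ⟨f e0 (Classical.arbitrary _)⟩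
    exact_mod_cast (Fintype.card_pos : 0 < Fintype.card (C e0))
  obtain ⟨m, hm, D, _, g, hD, hg⟩ := gkv_color C f r hr1 hr Finset.univ (2 * r) (by linarith)
  have : Nonempty D := ⟨g (fun _ => Classical.arbitrary _)⟩
  obtain ⟨y, hy⟩ := Fintype.exists_le_card_fiber_of_nsmul_le_card (M := ℝ) g
    (b := ((Nat.centralBinom k : ℝ) / 2) ^ m) (by
      rw [nsmul_eq_mul]
      calc (Fintype.card D : ℝ) * ((Nat.centralBinom k : ℝ) / 2) ^ m
          ≤ (2 * r) ^ m * ((Nat.centralBinom k : ℝ) / 2) ^ m := by gcongr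
        _ = (Fintype.card (gkvT d k) : ℝ) ^ m := by
            rw [← mul_pow, hrdef]; congr 1; field_simp
        _ ≤ _ := by simp)
  refine ⟨m, hm, {z // z ∈ Finset.univ.filter (fun z => g z = y)}, inferInstance,
    fun z p => (z.1 p.1).1 p.2, ?_, ?_⟩
  · intro u v huv a b hab
    have hu := (Finset.mem_filter.1 u.2).2
    have hv := (Finset.mem_filter.1 v.2).2
    obtain ⟨i, hi, hi'⟩ := hg u.1 v.1 (fun h => huv (Subtype.ext h)) (hu.trans hv.symm)
      ⟨(a, b), hab⟩ (Finset.mem_univ _)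
    obtain ⟨j, hj, hj'⟩ := gkv_merge_good (a, b) _ _ hi (congrArg Subtype.val hi')
    exact ⟨(i, j), hj, hj'⟩
  · rw [Fintype.card_coe]; exact hy

theorem gkv_lower (d : ℕ) (hd : 2 ≤ d) (δ : ℝ) (hδ : 0 < δ) :
    ∀ᶠ n : ℕ in Filter.atTop, 2 / (d : ℝ) - δ < Real.logb 2 (qiNumber n d) / n := by
  have : NeZero d := ⟨by omega⟩
  have hd0 : (0 : ℝ) < d := by positivity
  -- choice of k
  obtain ⟨k, hk4, hk⟩ : ∃ k : ℕ, 4 ≤ k ∧ Real.logb 2 (2 * k) / (d * k) < δ / 2 := by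
    have h1 : Filter.Tendsto (fun x : ℝ => Real.log x / x) Filter.atTop (nhds 0) := by
      simpa using Real.isLittleO_log_id_atTop.tendsto_div_nhds_zero
    have h2 : Filter.Tendsto (fun k : ℕ => (2 * k : ℝ)) Filter.atTop Filter.atTop :=
      tendsto_natCast_atTop_atTop.const_mul_atTop (by norm_num)
    have h3 := (h1.comp h2).const_mul (2 / (d * Real.log 2))
    rw [mul_zero] at h3
    have h4 := h3.eventually (gt_mem_nhds (show (0 : ℝ) < δ / 2 by linarith))
    obtain ⟨k, hk, hk4⟩ := (h4.and (Filter.eventually_ge_atTop 4)).exists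
    refine ⟨k, hk4, ?_⟩
    refine lt_of_eq_of_lt ?_ hk
    have : (0 : ℝ) < k := by exact_mod_cast (by omega : 0 < k)
    have : 0 < Real.log 2 := Real.log_pos (by norm_num)
    simp only [Function.comp, Real.logb]
    field_simp
  have hk0 : (0 : ℝ) < k := by exact_mod_cast (by omega : 0 < k)
  obtain ⟨m, hm, α, _, W, hW, hα⟩ := gkv_exists d k hd
  have hm0 : (0 : ℝ) < m := by exact_mod_cast hm
  set L : ℕ := m * (d * k) with hL
  have hL0 : (0 : ℝ) < L := by rw [hL]; push_cast; positivity
  have hLn : 0 < L := by exact_mod_cast hL0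
  have hM : (4 : ℝ) ^ k / k ≤ Nat.centralBinom k := by
    rw [div_le_iff₀ hk0, mul_comm]
    exact_mod_cast (Nat.four_pow_lt_mul_centralBinom k hk4).le
  have hα' : ((4 : ℝ) ^ k / (2 * k)) ^ m ≤ Fintype.card α := by
    refine le_trans (pow_le_pow_left₀ (by positivity) ?_ m) hα
    rw [mul_comm, ← div_div]
    gcongr
  have hαpos : (0 : ℝ) < Fintype.card α := lt_of_lt_of_le (by positivity) hα'
  have hα1 : (1 : ℝ) ≤ Fintype.card α := by
    have : 0 < Fintype.card α := by exact_mod_cast hαpos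
    exact_mod_cast this
  set ρ : ℝ := Real.logb 2 (Fintype.card α) / L with hρ
  have hlog0 : 0 ≤ Real.logb 2 (Fintype.card α) := Real.logb_nonneg (by norm_num) hα1
  have hρlow : 2 / (d : ℝ) - δ / 2 < ρ := by
    have h1 : (m : ℝ) * (2 * k - Real.logb 2 (2 * k)) ≤ Real.logb 2 (Fintype.card α) := by
      have h2 := Real.logb_le_logb_of_le (b := 2) (by norm_num) (by positivity) hα'
      rw [Real.logb_pow, Real.logb_div (by positivity) (by positivity), Real.logb_pow] at h2
      have h4 : Real.logb 2 4 = 2 := by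
        rw [show (4 : ℝ) = 2 ^ (2 : ℝ) by norm_num]
        exact Real.logb_rpow (by norm_num) (by norm_num)
      rw [h4] at h2
      linarith
    have h3 : 2 / (d : ℝ) - Real.logb 2 (2 * k) / (d * k) ≤ ρ := by
      rw [hρ, le_div_iff₀ hL0]
      refine le_trans (le_of_eq ?_) h1
      rw [hL]; push_cast; field_simp
    linarith
  -- the limit
  have hlim : Filter.Tendsto (fun n : ℕ => ρ - ρ * (d + L) / (n : ℝ)) Filter.atTop (nhds ρ) := by
    have := (tendsto_const_div_atTop_nhds_zero_nat (ρ * (d + L))).const_sub ρ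
    simpa using this
  have hev := hlim.eventually (lt_mem_nhds (show 2 / (d : ℝ) - δ < ρ by linarith))
  filter_upwards [hev, Filter.eventually_ge_atTop (d + 1)] with n hn hnd
  refine hn.trans_le ?_
  have hn0 : (0 : ℝ) < n := by exact_mod_cast (by omega : 0 < n)
  set q := (n - d) / L with hq
  have hfam := gkv_words n d W hW q (by
    have h1 : q * L ≤ n - d := Nat.div_mul_le_self _ _
    have h2 : Fintype.card (Fin m × (Fin d × Fin k)) = L := by simp [hL]
    rw [h2]
    omega)
  have hle : Fintype.card α ^ q ≤ qiNumber n d := le_csSup (gkv_bdd n d hd) hfam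
  have hle' : (q : ℝ) * Real.logb 2 (Fintype.card α) ≤ Real.logb 2 (qiNumber n d) := by
    rw [← Real.logb_pow]
    exact Real.logb_le_logb_of_le (by norm_num) (by positivity) (by exact_mod_cast hle)
  have hqlow : (n : ℝ) - d - L ≤ q * L := by
    have h1 : n - d < (q + 1) * L := by
      rw [hq, mul_comm]; exact Nat.lt_mul_div_succ _ hLn
    have h2 : n ≤ (q + 1) * L + d := by omega
    have h3 : (n : ℝ) ≤ (q + 1) * L + d := by exact_mod_cast h2
    linarith
  rw [le_div_iff₀ hn0, sub_mul, div_mul_cancel₀ _ hn0.ne']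
  refine le_trans ?_ hle'
  have hρ0 : 0 ≤ ρ := by positivity
  have h5 : Real.logb 2 (Fintype.card α) = ρ * L := by rw [hρ]; field_simp
  rw [h5]
  nlinarith [mul_le_mul_of_nonneg_left hqlow hρ0]

/-- **Theorem (Gargano–Körner–Vaccaro).** For every `d ≥ 2`,
`lim_{n → ∞} (1/n) · log₂ N(n, d) = 2 / d`. -/
theorem stmt11 (d : ℕ) (hd : 2 ≤ d) :
    Filter.Tendsto (fun n : ℕ => Real.logb 2 (qiNumber n d) / n)
      Filter.atTop (nhds (2 / (d : ℝ))) := by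
  have hd0 : (0 : ℝ) < d := by exact_mod_cast (by omega : 0 < d)
  refine tendsto_order.2 ⟨fun a ha => ?_, fun a ha => ?_⟩
  · have := gkv_lower d hd (2 / (d : ℝ) - a) (by linarith)
    simpa using this
  · filter_upwards [Filter.eventually_ge_atTop 1] with n hn
    refine lt_of_le_of_lt ?_ ha
    have hn0 : (0 : ℝ) < n := by exact_mod_cast hn
    rw [div_le_iff₀ hn0]
    have h := gkv_upper n d _ hd (gkv_mem n d hd)
    rcases Nat.eq_zero_or_pos (qiNumber n d) with h0 | h0
    · rw [h0]; simp; positivity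
    · rw [Real.logb_le_iff_le_rpow (by norm_num) (by exact_mod_cast h0)]
      convert h using 2
      ring
end
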